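/- arXiv:1410.8675 — 7 statements merged into one kernel-verified Lean document; each statement's English description precedes it below -/
import Mathlib

section
/- Let D ∈ ℕ, b ∈ ℝ^D and λ > 0. Let c* be the (unique) point of the ℓ1-ball {c ∈ ℝ^D : ‖c‖₁ ≤ λ} closest to b in Euclidean norm, i.e. the minimizer of c ↦ ‖c − b‖₂ over that ball. Then b − c* is the unique minimizer over ℝ^D of the function a ↦ (1/2)‖a − b‖₂² + λ‖a‖∞. -/
/-- The objective `a ↦ (1/2)‖a − b‖₂² + λ‖a‖∞`. -/
noncomputable def linfObj (D : ℕ) (lam : ℝ) (b a : Fin D → ℝ) : ℝ :=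
  (1 / 2) * ∑ d, (a d - b d) ^ 2 + lam * ⨆ d, |a d|

/-- Variational inequality for a point of a convex set minimizing the squared Euclidean distance. -/
lemma sum_sub_mul_sub_nonpos_of_forall_sum_sq_le {ι : Type*} [Fintype ι] {s : Set (ι → ℝ)}
    (hs : Convex ℝ s) {b u : ι → ℝ} (hu : u ∈ s)
    (hmin : ∀ c ∈ s, ∑ i, (u i - b i) ^ 2 ≤ ∑ i, (c i - b i) ^ 2) {c : ι → ℝ} (hc : c ∈ s) :
    ∑ i, (c i - u i) * (b i - u i) ≤ 0 := by
  set x := ∑ i, (c i - u i) * (b i - u i) with hx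
  set N := ∑ i, (c i - u i) ^ 2 with hN
  by_contra! hpos
  have hN0 : 0 ≤ N := Finset.sum_nonneg fun i _ => sq_nonneg _
  set t := x / (x + N) with ht
  have ht0 : 0 < t := by positivity
  have htx : t * (x + N) = x := by rw [ht]; field_simp
  have ht1 : t ≤ 1 := (div_le_one (by positivity)).2 (by linarith)
  have hle := hmin _ (hs.add_smul_sub_mem hu hc ⟨ht0.le, ht1⟩)
  have hexp : ∑ i, ((u + t • (c - u)) i - b i) ^ 2 =
      ∑ i, (u i - b i) ^ 2 - 2 * t * x + t ^ 2 * N := by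
    rw [hx, hN, Finset.mul_sum, Finset.mul_sum, ← Finset.sum_sub_distrib,
      ← Finset.sum_add_distrib]
    refine Finset.sum_congr rfl fun i _ => ?_
    simp only [Pi.add_apply, Pi.smul_apply, Pi.sub_apply, smul_eq_mul]
    ring
  rw [hexp] at hle
  have hmul : t * (2 * x) ≤ t * (t * N) := by linarith
  have := le_of_mul_le_mul_left hmul ht0
  have : 0 < t * x := mul_pos ht0 hpos
  linarith

lemma convex_setOf_sum_abs_le {ι : Type*} [Fintype ι] (r : ℝ) :
    Convex ℝ {c : ι → ℝ | ∑ i, |c i| ≤ r} := by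
  intro x hx y hy α β hα hβ hαβ
  simp only [Set.mem_ofPred_eq] at hx hy ⊢
  calc ∑ i, |(α • x + β • y) i| ≤ ∑ i, (α * |x i| + β * |y i|) := by
        refine Finset.sum_le_sum fun i _ => (abs_add_le _ _).trans_eq ?_
        simp [abs_mul, abs_of_nonneg hα, abs_of_nonneg hβ]
    _ = α * ∑ i, |x i| + β * ∑ i, |y i| := by
        rw [Finset.sum_add_distrib, Finset.mul_sum, Finset.mul_sum]
    _ ≤ α * r + β * r := by gcongr
    _ = r := by rw [← add_mul, hαβ, one_mul]

/-- Hölder's inequality for the `ℓ1` and `ℓ∞` norms. -/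
lemma sum_mul_le_mul_iSup_abs {ι : Type*} [Fintype ι] {r : ℝ} {c : ι → ℝ}
    (hc : ∑ i, |c i| ≤ r) (a : ι → ℝ) : ∑ i, c i * a i ≤ r * ⨆ i, |a i| := by
  calc ∑ i, c i * a i ≤ ∑ i, |c i| * ⨆ j, |a j| := by
        refine Finset.sum_le_sum fun i _ => (le_abs_self _).trans ?_
        rw [abs_mul]
        gcongr
        exact le_ciSup (f := fun j => |a j|) (Set.finite_range _).bddAbove i
    _ = (∑ i, |c i|) * ⨆ j, |a j| := (Finset.sum_mul ..).symm
    _ ≤ r * ⨆ i, |a i| := by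
        gcongr
        exact Real.iSup_nonneg fun i => abs_nonneg _

/-- A bound on a linear functional over the `ℓ1`-ball controls the `ℓ∞` norm of its coefficients. -/
lemma mul_iSup_abs_le_of_forall_sum_mul_le {ι : Type*} [Fintype ι] {r : ℝ} (hr : 0 ≤ r)
    {p : ι → ℝ} {M : ℝ} (h : ∀ c : ι → ℝ, ∑ i, |c i| ≤ r → ∑ i, c i * p i ≤ M) :
    r * ⨆ i, |p i| ≤ M := by
  classical
  rw [Real.mul_iSup_of_nonneg hr]
  refine Real.iSup_le (fun j => ?_) (by simpa using h 0 (by simpa using hr))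
  have hsingle : ∀ s : ℝ, |s| ≤ r → s * p j ≤ M := fun s hs => by
    have := h (Pi.single j s) (by
      rw [Finset.sum_eq_single j (fun i _ hi => by simp [hi]) (by simp)]
      simpa using hs)
    rwa [Finset.sum_eq_single j (fun i _ hi => by simp [hi]) (by simp), Pi.single_eq_same] at this
  rcases abs_cases (p j) with ⟨hp, -⟩ | ⟨hp, -⟩
  · rw [hp]
    exact hsingle r (abs_of_nonneg hr).le
  · rw [hp, mul_neg, ← neg_mul]
    exact hsingle (-r) (by rw [abs_neg, abs_of_nonneg hr])

/-- If `c*` is the point of the ℓ1-ball `{c : ‖c‖₁ ≤ λ}` closest to `b` in Euclidean norm,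
then `b − c*` is the unique minimizer over `ℝ^D` of `a ↦ (1/2)‖a − b‖₂² + λ‖a‖∞`. -/
theorem l1_projection_gives_linf_prox
    (D : ℕ) (b : Fin D → ℝ) (lam : ℝ) (hlam : 0 < lam)
    (cstar : Fin D → ℝ)
    (hmem : ∑ d, |cstar d| ≤ lam)
    (hproj : ∀ c : Fin D → ℝ, ∑ d, |c d| ≤ lam →
      Real.sqrt (∑ d, (cstar d - b d) ^ 2) ≤ Real.sqrt (∑ d, (c d - b d) ^ 2)) :
    (∀ a : Fin D → ℝ, linfObj D lam b (b - cstar) ≤ linfObj D lam b a) ∧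
    (∀ a : Fin D → ℝ, (∀ y : Fin D → ℝ, linfObj D lam b a ≤ linfObj D lam b y) →
      a = b - cstar) := by
  have hvar : ∀ c : Fin D → ℝ, ∑ d, |c d| ≤ lam →
      ∑ d, c d * (b - cstar) d ≤ ∑ d, cstar d * (b - cstar) d := fun c hc => by
    have := sum_sub_mul_sub_nonpos_of_forall_sum_sq_le (b := b) (convex_setOf_sum_abs_le lam) hmem
      (fun c hc => (Real.sqrt_le_sqrt_iff (Finset.sum_nonneg fun d _ => sq_nonneg _)).1
        (hproj c hc)) hc
    simp only [sub_mul, Finset.sum_sub_distrib] at this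
    simpa using this
  have hsup := mul_iSup_abs_le_of_forall_sum_mul_le hlam.le hvar
  have hgrowth : ∀ a : Fin D → ℝ,
      linfObj D lam b (b - cstar) + (1 / 2) * ∑ d, (a d - (b - cstar) d) ^ 2 ≤
        linfObj D lam b a := fun a => by
    have hhol := sum_mul_le_mul_iSup_abs hmem a
    have hexp : (1 / 2) * ∑ d, ((b - cstar) d - b d) ^ 2 + ∑ d, cstar d * (b - cstar) d +
        (1 / 2) * ∑ d, (a d - (b - cstar) d) ^ 2 =
        (1 / 2) * ∑ d, (a d - b d) ^ 2 + ∑ d, cstar d * a d := by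
      simp only [Finset.mul_sum, ← Finset.sum_add_distrib]
      refine Finset.sum_congr rfl fun d _ => ?_
      simp only [Pi.sub_apply]
      ring
    unfold linfObj
    linarith
  have hnonneg : ∀ a : Fin D → ℝ, 0 ≤ ∑ d, (a d - (b - cstar) d) ^ 2 := fun a =>
    Finset.sum_nonneg fun d _ => sq_nonneg _
  refine ⟨fun a => by linarith [hgrowth a, hnonneg a], fun a ha => ?_⟩
  have hzero : ∑ d, (a d - (b - cstar) d) ^ 2 = 0 :=
    le_antisymm (by linarith [hgrowth a, ha (b - cstar)]) (hnonneg a)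
  rw [Finset.sum_eq_zero_iff_of_nonneg fun d _ => sq_nonneg _] at hzero
  funext d
  exact sub_eq_zero.1 (pow_eq_zero_iff two_ne_zero |>.1 (hzero d (Finset.mem_univ d)))
end

section
/- Let D ∈ ℕ, b ∈ ℝ^D and λ > 0, and let a = S_λ(b) be the soft-thresholding of b. If ‖b‖∞ > λ, then ‖a‖∞ = ‖b‖∞ − λ, the set of coordinates attaining the maximum absolute value is preserved, i.e. {d : |a_d| = ‖a‖∞} = {d : |b_d| = ‖b‖∞}, and for every d in this set, sgn(a_d) = sgn(b_d). -/
/-- Soft-thresholding operator: `(S_λ(b))_d = sgn(b_d) · max(|b_d| − λ, 0)`. -/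
noncomputable def softThresh (D : ℕ) (lam : ℝ) (b : Fin D → ℝ) : Fin D → ℝ :=
  fun d => Real.sign (b d) * max (|b d| - lam) 0

theorem abs_softThresh (D : ℕ) {lam : ℝ} (hlam : 0 ≤ lam) (b : Fin D → ℝ) (d : Fin D) :
    |softThresh D lam b d| = max (|b d| - lam) 0 := by
  have hmax : 0 ≤ max (|b d| - lam) 0 := le_max_right _ _
  rcases lt_trichotomy (b d) 0 with hb | hb | hb
  · simp [softThresh, Real.sign_of_neg hb, abs_of_nonneg hmax]
  · simp [softThresh, hb, hlam]
  · simp [softThresh, Real.sign_of_pos hb, abs_of_nonneg hmax]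

theorem sign_softThresh (D : ℕ) {lam : ℝ} (b : Fin D → ℝ) (d : Fin D) (h : lam < |b d|) :
    Real.sign (softThresh D lam b d) = Real.sign (b d) := by
  have hmax : 0 < max (|b d| - lam) 0 := lt_max_of_lt_left (sub_pos.2 h)
  rcases lt_trichotomy (b d) 0 with hb | hb | hb
  · simp only [softThresh, Real.sign_of_neg hb]
    exact Real.sign_of_neg (by linarith)
  · simp [softThresh, hb]
  · simp only [softThresh, Real.sign_of_pos hb]
    exact Real.sign_of_pos (by linarith)

/-- If `‖b‖∞ > λ` and `a = S_λ(b)`, then `‖a‖∞ = ‖b‖∞ − λ`, the set of coordinates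
attaining the maximal absolute value is preserved, and on this set the signs of the
components of `a` and `b` agree. -/
theorem softThresh_preserves_argmax
    (D : ℕ) (b : Fin D → ℝ) (lam : ℝ) (hlam : 0 < lam)
    (h : lam < ⨆ d, |b d|) :
    (⨆ d, |softThresh D lam b d|) = (⨆ d, |b d|) - lam ∧
    {d : Fin D | |softThresh D lam b d| = ⨆ e, |softThresh D lam b e|} =
      {d : Fin D | |b d| = ⨆ e, |b e|} ∧
    (∀ d : Fin D, |b d| = (⨆ e, |b e|) →
      Real.sign (softThresh D lam b d) = Real.sign (b d)) := by
  have : Nonempty (Fin D) := by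
    by_contra hD
    rw [not_nonempty_iff] at hD
    rw [Real.iSup_of_isEmpty] at h
    exact hlam.not_gt h
  have hle : ∀ d, |b d| ≤ ⨆ e, |b e| := le_ciSup (Set.finite_range fun e => |b e|).bddAbove
  obtain ⟨m, hm⟩ := exists_eq_ciSup_of_finite (f := fun e => |b e|)
  have hsup : (⨆ d, |softThresh D lam b d|) = (⨆ d, |b d|) - lam := by
    simp only [abs_softThresh D hlam.le]
    apply le_antisymm
    · exact ciSup_le fun d => max_le (by linarith [hle d]) (by linarith)
    · refine le_ciSup_of_le (Set.finite_range _).bddAbove m (le_max_of_le_left ?_)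
      exact (congrArg (· - lam) hm).ge
  refine ⟨hsup, ?_, fun d hd => sign_softThresh D b d (hd ▸ h)⟩
  ext d
  rw [Set.mem_ofPred_eq, Set.mem_ofPred_eq, hsup, abs_softThresh D hlam.le]
  constructor
  · intro hd
    rcases max_cases (|b d| - lam) 0 with ⟨he, _⟩ | ⟨he, _⟩ <;> linarith
  · intro hd
    rw [hd, max_eq_left (by linarith)]
end

section
/- Let D ∈ ℕ, b ∈ ℝ^D and λ > 0, and let a = S_λ(b) be the soft-thresholding of b. Then every subgradient of the norm ‖·‖∞ at b is also a subgradient of ‖·‖∞ at a; that is, for every v ∈ ℝ^D, if ‖y‖∞ ≥ ‖b‖∞ + ⟨v, y − b⟩ for all y ∈ ℝ^D, then ‖y‖∞ ≥ ‖a‖∞ + ⟨v, y − a⟩ for all y ∈ ℝ^D. -/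
theorem iSup_abs_eq_norm {ι : Type*} [Fintype ι] (y : ι → ℝ) : (⨆ i, |y i|) = ‖y‖ := by
  apply le_antisymm
  · exact Real.iSup_le (fun i => norm_le_pi_norm y i) (norm_nonneg y)
  · exact (pi_norm_le_iff_of_nonneg (Real.iSup_nonneg fun i => abs_nonneg (y i))).2
      fun i => le_ciSup (f := fun i => |y i|) (Set.finite_range _).bddAbove i

theorem abs_sub_softThresh_le {D : ℕ} {lam : ℝ} (hlam : 0 ≤ lam) (b : Fin D → ℝ) (d : Fin D) :
    |b d - softThresh D lam b d| ≤ lam := by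
  unfold softThresh
  rcases lt_trichotomy (b d) 0 with h | h | h
  · rw [Real.sign_of_neg h, abs_of_neg h, abs_le]
    constructor <;> rcases max_cases (-b d - lam) 0 with h' | h' <;> linarith
  · simpa [h] using hlam
  · rw [Real.sign_of_pos h, abs_of_pos h, abs_le]
    constructor <;> rcases max_cases (b d - lam) 0 with h' | h' <;> linarith

theorem abs_softThresh_le {D : ℕ} (lam : ℝ) (b : Fin D → ℝ) (d : Fin D) :
    |softThresh D lam b d| ≤ max (|b d| - lam) 0 := by
  have h0 : 0 ≤ max (|b d| - lam) 0 := le_max_right _ _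
  have hs : |Real.sign (b d)| ≤ 1 := by
    rcases Real.sign_apply_eq (b d) with h | h | h <;> simp [h]
  rw [softThresh, abs_mul, abs_of_nonneg h0]
  exact mul_le_of_le_one_left h0 hs

theorem norm_softThresh_le {D : ℕ} (lam : ℝ) (b : Fin D → ℝ) :
    ‖softThresh D lam b‖ ≤ max (‖b‖ - lam) 0 :=
  (pi_norm_le_iff_of_nonneg (le_max_right _ _)).2 fun d =>
    (abs_softThresh_le lam b d).trans
      (max_le_max_right _ (sub_le_sub_right (norm_le_pi_norm b d) lam))

/-- Every subgradient of the ℓ∞ norm at `b` is a subgradient of the ℓ∞ norm at the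
soft-thresholding `a = S_λ(b)`. -/
theorem subgradient_linf_of_softThresh
    (D : ℕ) (b : Fin D → ℝ) (lam : ℝ) (hlam : 0 < lam) (v : Fin D → ℝ)
    (hv : ∀ y : Fin D → ℝ, (⨆ d, |b d|) + ∑ d, v d * (y d - b d) ≤ ⨆ d, |y d|) :
    ∀ y : Fin D → ℝ,
      (⨆ d, |softThresh D lam b d|) + ∑ d, v d * (y d - softThresh D lam b d) ≤
        ⨆ d, |y d| := by
  simp only [iSup_abs_eq_norm] at hv ⊢
  have hdual (z : Fin D → ℝ) : ∑ d, v d * z d ≤ ‖z‖ := by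
    have h := hv (b + z)
    simp only [Pi.add_apply, add_sub_cancel_left] at h
    linarith [norm_add_le b z]
  have hb : ‖b‖ ≤ ∑ d, v d * b d := by
    have h := hv 0
    simp only [Pi.zero_apply, zero_sub, mul_neg, Finset.sum_neg_distrib, norm_zero] at h
    linarith
  have ha : ‖softThresh D lam b‖ ≤ ∑ d, v d * softThresh D lam b d := by
    have hnorm := norm_softThresh_le lam b
    rcases le_total (‖b‖ - lam) 0 with h | h
    · rw [max_eq_right h] at hnorm
      simp [norm_le_zero_iff.1 hnorm]
    · rw [max_eq_left h] at hnorm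
      have hdiff : ‖b - softThresh D lam b‖ ≤ lam :=
        (pi_norm_le_iff_of_nonneg hlam.le).2 (abs_sub_softThresh_le hlam.le b)
      have hsub := hdual (b - softThresh D lam b)
      simp only [Pi.sub_apply, mul_sub, Finset.sum_sub_distrib] at hsub
      linarith
  intro y
  simp only [mul_sub, Finset.sum_sub_distrib]
  linarith [hdual y]
end

section
/- (Decomposition of the proximal map.) Let D, P ∈ ℕ, let η, λ_P, λ_0 > 0, and let B ∈ ℝ^{D×(P+1)} with columns b_0, b_1, …, b_P. Define Ω(A) = λ_P Σ_{p=1}^P ‖a_p‖∞ + λ_0 Σ_{p=0}^P Σ_{d=1}^D |a_{dp}| for a matrix A with columns a_0, …, a_P. Let M_1(B) be the unique minimizer of A ↦ (1/2)‖A − B‖_F² + η λ_P Σ_{p=1}^P ‖a_p‖∞, and let M_2(C) be the matrix obtained from C by applying soft-thresholding S_{η λ_0} to every entry (equivalently, the unique minimizer of A ↦ (1/2)‖A − C‖_F² + η λ_0 Σ_{p=0}^P Σ_d |a_{dp}|). Then M_2(M_1(B)) is the unique minimizer over ℝ^{D×(P+1)} of A ↦ (1/2)‖A − B‖_F² + η·Ω(A).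 -/
/-- The regularizer `Ω(A) = λ_P Σ_{p=1}^P ‖a_p‖∞ + λ_0 Σ_{p=0}^P Σ_d |a_{dp}|`. -/
noncomputable def Omega (D P : ℕ) (lamP lam0 : ℝ)
    (A : Matrix (Fin D) (Fin (P + 1)) ℝ) : ℝ :=
  lamP * ∑ p : Fin P, (⨆ d, |A d p.succ|) + lam0 * ∑ p, ∑ d, |A d p|

/-- Objective of the full proximal map: `A ↦ (1/2)‖A − B‖_F² + η·Ω(A)`. -/
noncomputable def proxObj (D P : ℕ) (eta lamP lam0 : ℝ)
    (B A : Matrix (Fin D) (Fin (P + 1)) ℝ) : ℝ :=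
  (1 / 2) * ∑ d, ∑ p, (A d p - B d p) ^ 2 + eta * Omega D P lamP lam0 A

/-- Objective of the first sub-proximal map (group ℓ∞ part only). -/
noncomputable def proxObj1 (D P : ℕ) (eta lamP : ℝ)
    (B A : Matrix (Fin D) (Fin (P + 1)) ℝ) : ℝ :=
  (1 / 2) * ∑ d, ∑ p, (A d p - B d p) ^ 2 + eta * lamP * ∑ p : Fin P, ⨆ d, |A d p.succ|

/-- Entrywise soft-thresholding with threshold `t`: the second sub-proximal map `M_2`. -/
noncomputable def entrywiseSoftThresh (D P : ℕ) (t : ℝ)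
    (C : Matrix (Fin D) (Fin (P + 1)) ℝ) : Matrix (Fin D) (Fin (P + 1)) ℝ :=
  fun d p => Real.sign (C d p) * max (|C d p| - t) 0

/-- The Frobenius inner product of two real matrices. -/
def frobInner {m n : Type*} [Fintype m] [Fintype n] (A B : Matrix m n ℝ) : ℝ :=
  ∑ d, ∑ p, A d p * B d p

section frobInner

variable {m n : Type*} [Fintype m] [Fintype n]

theorem frobInner_add_right (A B C : Matrix m n ℝ) :
    frobInner A (B + C) = frobInner A B + frobInner A C := by
  simp only [frobInner, Matrix.add_apply, mul_add, Finset.sum_add_distrib]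

theorem frobInner_sub_right (A B C : Matrix m n ℝ) :
    frobInner A (B - C) = frobInner A B - frobInner A C := by
  simp only [frobInner, Matrix.sub_apply, mul_sub, Finset.sum_sub_distrib]

theorem frobInner_smul_right (s : ℝ) (A B : Matrix m n ℝ) :
    frobInner A (s • B) = s * frobInner A B := by
  simp only [frobInner, Matrix.smul_apply, smul_eq_mul, mul_left_comm _ s, Finset.mul_sum]

theorem frobInner_comm (A B : Matrix m n ℝ) : frobInner A B = frobInner B A := by
  simp only [frobInner, mul_comm]

theorem frobInner_add_left (A B C : Matrix m n ℝ) :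
    frobInner (A + B) C = frobInner A C + frobInner B C := by
  simp only [frobInner_comm _ C, frobInner_add_right]

theorem frobInner_sub_left (A B C : Matrix m n ℝ) :
    frobInner (A - B) C = frobInner A C - frobInner B C := by
  simp only [frobInner_comm _ C, frobInner_sub_right]

theorem frobInner_smul_left (s : ℝ) (A B : Matrix m n ℝ) :
    frobInner (s • A) B = s * frobInner A B := by
  simp only [frobInner_comm _ B, frobInner_smul_right]

theorem frobInner_self_nonneg (A : Matrix m n ℝ) : 0 ≤ frobInner A A :=
  Finset.sum_nonneg fun _ _ => Finset.sum_nonneg fun _ _ => mul_self_nonneg _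

theorem eq_zero_of_frobInner_self_nonpos {A : Matrix m n ℝ} (h : frobInner A A ≤ 0) :
    A = 0 := by
  have hrow : ∀ d, 0 ≤ ∑ p, A d p * A d p :=
    fun _ => Finset.sum_nonneg fun _ _ => mul_self_nonneg _
  have h0 : frobInner A A = 0 := le_antisymm h (frobInner_self_nonneg A)
  ext d p
  have hd := (Finset.sum_eq_zero_iff_of_nonneg fun d _ => hrow d).1 h0 d (Finset.mem_univ d)
  have hp := (Finset.sum_eq_zero_iff_of_nonneg fun p _ => mul_self_nonneg (A d p)).1 hd p
    (Finset.mem_univ p)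
  exact mul_self_eq_zero.1 hp

theorem sum_sq_sub_eq_frobInner (A B : Matrix m n ℝ) :
    ∑ d, ∑ p, (A d p - B d p) ^ 2 = frobInner (A - B) (A - B) := by
  simp only [frobInner, Matrix.sub_apply, sq]

end frobInner

theorem le_of_forall_le_add_mul {a b c : ℝ}
    (h : ∀ s : ℝ, 0 < s → s < 1 → a ≤ b + s * c) : a ≤ b := by
  have ht : Filter.Tendsto (fun s : ℝ => b + s * c) (nhdsWithin 0 (Set.Ioi 0)) (nhds b) := by
    have : Continuous fun s : ℝ => b + s * c := by fun_prop
    simpa using (this.tendsto 0).mono_left nhdsWithin_le_nhds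
  refine ge_of_tendsto ht ?_
  filter_upwards [Ioo_mem_nhdsGT (zero_lt_one' ℝ)] with s hs using h s hs.1 hs.2

section frobInner

variable {m n : Type*} [Fintype m] [Fintype n] {g : Matrix m n ℝ → ℝ} {B C : Matrix m n ℝ}

/-- At the proximal point `C` of a sublinear function `g`, the residual `B - C` is a linear
minorant of `g`. -/
theorem frobInner_sub_le_of_isProx (hadd : ∀ A A', g (A + A') ≤ g A + g A')
    (hsmul : ∀ (s : ℝ) A, 0 ≤ s → g (s • A) = s * g A)
    (hC : ∀ A, 1 / 2 * frobInner (C - B) (C - B) + g C ≤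
      1 / 2 * frobInner (A - B) (A - B) + g A) (A : Matrix m n ℝ) :
    frobInner (B - C) A ≤ g A := by
  refine le_of_forall_le_add_mul (c := 1 / 2 * frobInner A A) fun s hs _ => ?_
  have h := hC (C + s • A)
  have hg := (hadd C (s • A)).trans_eq (by rw [hsmul s A hs.le])
  simp only [frobInner_add_left, frobInner_add_right, frobInner_sub_left, frobInner_sub_right,
    frobInner_smul_left, frobInner_smul_right, frobInner_comm A C, frobInner_comm A B,
    frobInner_comm C B] at h ⊢
  refine le_of_mul_le_mul_left ?_ hs
  linarith

/-- At the proximal point `C` of a sublinear function `g`, the residual `B - C` supports `g`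
at `C`. -/
theorem le_frobInner_sub_of_isProx
    (hsmul : ∀ (s : ℝ) A, 0 ≤ s → g (s • A) = s * g A)
    (hC : ∀ A, 1 / 2 * frobInner (C - B) (C - B) + g C ≤
      1 / 2 * frobInner (A - B) (A - B) + g A) :
    g C ≤ frobInner (B - C) C := by
  refine le_of_forall_le_add_mul (c := 1 / 2 * frobInner C C) fun s hs hs1 => ?_
  have h := hC ((1 - s) • C)
  rw [hsmul (1 - s) C (by linarith)] at h
  simp only [frobInner_sub_left, frobInner_sub_right,
    frobInner_smul_left, frobInner_smul_right, frobInner_comm C B] at h ⊢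
  refine le_of_mul_le_mul_left ?_ hs
  linarith

end frobInner

theorem abs_sign_mul_max (c : ℝ) {t : ℝ} (ht : 0 ≤ t) :
    |Real.sign c * max (|c| - t) 0| = max (|c| - t) 0 := by
  rcases lt_trichotomy c 0 with h | rfl | h
  · simp [Real.sign_of_neg h]
  · simp [ht]
  · simp [Real.sign_of_pos h]

theorem abs_sub_sign_mul_max (c : ℝ) {t : ℝ} (ht : 0 ≤ t) :
    |c - Real.sign c * max (|c| - t) 0| = min |c| t := by
  rcases lt_trichotomy c 0 with h | rfl | h
  · rw [Real.sign_of_neg h, abs_of_neg h]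
    rcases le_total (-c) t with h1 | h1
    · rw [max_eq_right (by linarith), min_eq_left h1, abs_of_neg (by linarith)]; ring
    · rw [max_eq_left (by linarith), min_eq_right h1, abs_of_nonpos (by linarith)]; ring
  · simp [ht]
  · rw [Real.sign_of_pos h, abs_of_pos h]
    rcases le_total c t with h1 | h1
    · rw [max_eq_right (by linarith), min_eq_left h1, abs_of_pos (by linarith)]; ring
    · rw [max_eq_left (by linarith), min_eq_right h1, abs_of_nonneg (by linarith)]; ring

/-- The residual of scalar soft-thresholding is a subgradient of `t * |·|`. -/
theorem sub_sign_mul_max_mul_le (a c : ℝ) {t : ℝ} (ht : 0 ≤ t) :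
    (c - Real.sign c * max (|c| - t) 0) * (a - Real.sign c * max (|c| - t) 0) ≤
      t * (|a| - |Real.sign c * max (|c| - t) 0|) := by
  rw [abs_sign_mul_max c ht]
  have hle : (c - Real.sign c * max (|c| - t) 0) * a ≤ t * |a| := by
    refine (le_abs_self _).trans ?_
    rw [abs_mul, abs_sub_sign_mul_max c ht]
    exact mul_le_mul_of_nonneg_right (min_le_right _ _) (abs_nonneg a)
  have heq : (c - Real.sign c * max (|c| - t) 0) * (Real.sign c * max (|c| - t) 0) =
      t * max (|c| - t) 0 := by
    rcases le_total |c| t with h1 | h1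
    · simp [max_eq_right (sub_nonpos.2 h1)]
    · rw [max_eq_left (sub_nonneg.2 h1)]
      rcases lt_trichotomy c 0 with h | rfl | h
      · rw [Real.sign_of_neg h, abs_of_neg h]; ring
      · have : t = 0 := le_antisymm (by simpa using h1) ht
        simp [this]
      · rw [Real.sign_of_pos h, abs_of_pos h]; ring
  linarith

section iSup

variable {ι : Type*} [Finite ι]

theorem iSup_abs_add_le (u v : ι → ℝ) : ⨆ i, |u i + v i| ≤ (⨆ i, |u i|) + ⨆ i, |v i| := by
  refine Real.iSup_le (fun i => (abs_add_le _ _).trans (add_le_add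
    (le_ciSup (f := fun i => |u i|) (Set.finite_range _).bddAbove i)
    (le_ciSup (f := fun i => |v i|) (Set.finite_range _).bddAbove i))) ?_
  exact add_nonneg (Real.iSup_nonneg fun _ => abs_nonneg _) (Real.iSup_nonneg fun _ => abs_nonneg _)

/-- Soft-thresholding splits the supremum norm of a vector additively. -/
theorem iSup_abs_softThresh_add_le (c : ι → ℝ) {t : ℝ} (ht : 0 ≤ t) :
    (⨆ i, |Real.sign (c i) * max (|c i| - t) 0|) +
      (⨆ i, |c i - Real.sign (c i) * max (|c i| - t) 0|) ≤ ⨆ i, |c i| := by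
  simp only [abs_sign_mul_max _ ht, abs_sub_sign_mul_max _ ht]
  have hle : ∀ i, |c i| ≤ ⨆ i, |c i| :=
    le_ciSup (f := fun i => |c i|) (Set.finite_range _).bddAbove
  have h0 : 0 ≤ ⨆ i, |c i| := Real.iSup_nonneg fun _ => abs_nonneg _
  generalize (⨆ i, |c i|) = M at *
  have hmax : ⨆ i, max (|c i| - t) 0 ≤ max (M - t) 0 :=
    Real.iSup_le (fun i => max_le_max_right 0 (sub_le_sub_right (hle i) t)) (le_max_right _ _)
  have hmin : ⨆ i, min |c i| t ≤ min M t :=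
    Real.iSup_le (fun i => min_le_min_right t (hle i)) (le_min h0 ht)
  have hM : max (M - t) 0 + min M t = M := by
    rcases le_total M t with h | h
    · rw [max_eq_right (by linarith), min_eq_left h]; ring
    · rw [max_eq_left (by linarith), min_eq_right h]; ring
  linarith

end iSup

/-- Decomposition of the proximal map: if `C = M_1(B)` minimizes the group-ℓ∞ proximal
objective, then `M_2(C)` (entrywise soft-thresholding of `C` with threshold `η λ_0`) is
the unique minimizer of `A ↦ (1/2)‖A − B‖_F² + η·Ω(A)`. -/
theorem proximal_map_decomposition
    (D P : ℕ) (eta lamP lam0 : ℝ) (heta : 0 < eta) (hlamP : 0 < lamP) (hlam0 : 0 < lam0)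
    (B C : Matrix (Fin D) (Fin (P + 1)) ℝ)
    (hC : ∀ A, proxObj1 D P eta lamP B C ≤ proxObj1 D P eta lamP B A) :
    (∀ A, proxObj D P eta lamP lam0 B (entrywiseSoftThresh D P (eta * lam0) C) ≤
        proxObj D P eta lamP lam0 B A) ∧
    (∀ A, (∀ A', proxObj D P eta lamP lam0 B A ≤ proxObj D P eta lamP lam0 B A') →
        A = entrywiseSoftThresh D P (eta * lam0) C) := by
  set S := entrywiseSoftThresh D P (eta * lam0) C
  have ht : 0 ≤ eta * lam0 := (mul_pos heta hlam0).le
  have hk : 0 ≤ eta * lamP := (mul_pos heta hlamP).le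
  let g : Matrix (Fin D) (Fin (P + 1)) ℝ → ℝ :=
    fun A => eta * lamP * ∑ p : Fin P, ⨆ d, |A d p.succ|
  have hadd : ∀ A A', g (A + A') ≤ g A + g A' := fun A A' => by
    rw [← mul_add, ← Finset.sum_add_distrib]
    exact mul_le_mul_of_nonneg_left (Finset.sum_le_sum fun p _ => iSup_abs_add_le _ _) hk
  have hsmul : ∀ (s : ℝ) A, 0 ≤ s → g (s • A) = s * g A := fun s A hs => by
    simp only [g, Matrix.smul_apply, smul_eq_mul, abs_mul, abs_of_nonneg hs,
      ← Real.mul_iSup_of_nonneg hs, ← Finset.mul_sum]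
    ring
  have hsplit : g S + g (C - S) ≤ g C := by
    rw [← mul_add, ← Finset.sum_add_distrib]
    exact mul_le_mul_of_nonneg_left
      (Finset.sum_le_sum fun p _ => iSup_abs_softThresh_add_le (fun d => C d p.succ) ht) hk
  have hprox : ∀ A, 1 / 2 * frobInner (C - B) (C - B) + g C ≤
      1 / 2 * frobInner (A - B) (A - B) + g A := fun A => by
    simpa only [proxObj1, sum_sq_sub_eq_frobInner] using hC A
  have hobj : ∀ A, proxObj D P eta lamP lam0 B A = 1 / 2 * frobInner (A - B) (A - B) + g A +
      eta * lam0 * ∑ d, ∑ p, |A d p| := fun A => by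
    simp only [proxObj, Omega, sum_sq_sub_eq_frobInner, g]
    rw [Finset.sum_comm (f := fun p d => |A d p|)]
    ring
  have hl1 : ∀ A, frobInner (C - S) (A - S) ≤
      eta * lam0 * ∑ d, ∑ p, |A d p| - eta * lam0 * ∑ d, ∑ p, |S d p| := fun A => by
    simp only [← mul_sub, ← Finset.sum_sub_distrib]
    simp only [frobInner, Finset.mul_sum]
    exact Finset.sum_le_sum fun d _ => Finset.sum_le_sum fun p _ =>
      sub_sign_mul_max_mul_le (A d p) (C d p) ht
  have key : ∀ A, proxObj D P eta lamP lam0 B S + 1 / 2 * frobInner (A - S) (A - S) ≤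
      proxObj D P eta lamP lam0 B A := fun A => by
    have hA := frobInner_sub_le_of_isProx hadd hsmul hprox A
    have hCS := frobInner_sub_le_of_isProx hadd hsmul hprox (C - S)
    have hCC := le_frobInner_sub_of_isProx hsmul hprox
    have hl := hl1 A
    rw [hobj, hobj]
    simp only [frobInner_sub_left, frobInner_sub_right, frobInner_comm A S, frobInner_comm A B,
      frobInner_comm S B, frobInner_comm C S]
      at hA hCS hCC hl ⊢
    linarith
  refine ⟨fun A => ?_, fun A hA => ?_⟩
  · linarith [key A, frobInner_self_nonneg (A - S)]
  · refine sub_eq_zero.1 (eq_zero_of_frobInner_self_nonpos ?_)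
    linarith [key A, hA S]
end

section
/- Let D ∈ ℕ. The ℓ1 norm is the convex envelope of the cardinality function on the unit ℓ∞-ball: (i) for every a ∈ ℝ^D with ‖a‖∞ ≤ 1, ‖a‖₁ ≤ #{d : a_d ≠ 0}; and (ii) for every convex function h : ℝ^D → ℝ satisfying h(a) ≤ #{d : a_d ≠ 0} for all a with ‖a‖∞ ≤ 1, one has h(a) ≤ ‖a‖₁ for all a with ‖a‖∞ ≤ 1. -/
/-- For a finite family of reals, the supremum of absolute values is at most `1` exactly when each
absolute value is. -/
theorem iSup_abs_le_one_iff {ι : Type*} [Finite ι] (a : ι → ℝ) :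
    (⨆ d, |a d|) ≤ 1 ↔ ∀ d, |a d| ≤ 1 :=
  ⟨fun h d => (le_ciSup (Set.finite_range fun d => |a d|).bddAbove d).trans h,
    fun h => Real.iSup_le h zero_le_one⟩

/-- The number of nonzero coordinates as a sum of indicators. -/
theorem ncard_ne_zero_eq_sum {ι : Type*} [Fintype ι] (a : ι → ℝ) :
    ({d : ι | a d ≠ 0}.ncard : ℝ) = ∑ d, if a d ≠ 0 then (1 : ℝ) else 0 := by
  rw [Finset.sum_boole, Set.ncard_eq_toFinset_card']
  simp

theorem sum_abs_update {ι : Type*} [Fintype ι] [DecidableEq ι] (a : ι → ℝ) (i : ι) (c : ℝ) :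
    ∑ d, |Function.update a i c d| = |c| + ∑ d ∈ Finset.univ.erase i, |a d| := by
  rw [← Finset.add_sum_erase _ _ (Finset.mem_univ i), Function.update_self]
  congr 1
  refine Finset.sum_congr rfl fun d hd => ?_
  rw [Function.update_of_ne (Finset.ne_of_mem_erase hd)]

/-- A convex function dominated by the ℓ1 norm at the points with coordinates in `{-1, 0, 1}` is
dominated by it at every point of the unit ℓ∞-ball whose coordinates outside `s` lie in
`{-1, 0, 1}`. -/
theorem ConvexOn.le_sum_abs_of_forall_notMem {ι : Type*} [Fintype ι] [DecidableEq ι]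
    {h : (ι → ℝ) → ℝ} (hh : ConvexOn ℝ Set.univ h)
    (hv : ∀ a : ι → ℝ, (∀ d, a d = 0 ∨ |a d| = 1) → h a ≤ ∑ d, |a d|) (s : Finset ι)
    (a : ι → ℝ) (ha : ∀ d, |a d| ≤ 1) (hs : ∀ d ∉ s, a d = 0 ∨ |a d| = 1) :
    h a ≤ ∑ d, |a d| := by
  induction s using Finset.induction_on generalizing a with
  | empty => exact hv a fun d => hs d (Finset.notMem_empty d)
  | insert i s hi ih =>
    have key : ∀ c : ℝ, c = 0 ∨ |c| = 1 →
        h (Function.update a i c) ≤ |c| + ∑ d ∈ Finset.univ.erase i, |a d| := by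
      intro c hc
      rw [← sum_abs_update]
      apply ih
      · intro d
        rcases eq_or_ne d i with rfl | hd
        · rw [Function.update_self]
          rcases hc with rfl | hc
          · simp
          · exact hc.le
        · rw [Function.update_of_ne hd]
          exact ha d
      · intro d hds
        rcases eq_or_ne d i with rfl | hd
        · rwa [Function.update_self]
        · rw [Function.update_of_ne hd]
          exact hs d (by simp [hd, hds])
    obtain ⟨c, hc, hac⟩ : ∃ c : ℝ, |c| = 1 ∧ |a i| * c = a i := by
      rcases abs_choice (a i) with h1 | h1
      · exact ⟨1, by simp, by simp [h1]⟩
      · exact ⟨-1, by simp, by simp [h1]⟩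
    have hcomb : |a i| • Function.update a i c + (1 - |a i|) • Function.update a i 0 = a := by
      ext d
      rcases eq_or_ne d i with rfl | hd
      · simp [hac]
      · simp only [Pi.add_apply, Pi.smul_apply, Function.update_of_ne hd, smul_eq_mul]
        ring
    have hconv := hh.2 (Set.mem_univ (Function.update a i c))
      (Set.mem_univ (Function.update a i 0)) (abs_nonneg (a i)) (sub_nonneg.2 (ha i))
      (add_sub_cancel _ _)
    rw [hcomb, smul_eq_mul, smul_eq_mul] at hconv
    have h1 := mul_le_mul_of_nonneg_left (key c (Or.inr hc)) (abs_nonneg (a i))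
    have h0 := mul_le_mul_of_nonneg_left (key 0 (Or.inl rfl)) (sub_nonneg.2 (ha i))
    rw [hc] at h1
    rw [abs_zero] at h0
    rw [← Finset.add_sum_erase _ _ (Finset.mem_univ i)]
    linarith


/-- The ℓ1 norm is the convex envelope of the cardinality function on the unit ℓ∞-ball:
(i) `‖a‖₁ ≤ #{d : a_d ≠ 0}` on the ball, and (ii) any convex minorant of the cardinality
on the ball is dominated by the ℓ1 norm on the ball. -/
theorem l1_convex_envelope_of_card (D : ℕ) :
    (∀ a : Fin D → ℝ, (⨆ d, |a d|) ≤ 1 →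
      ∑ d, |a d| ≤ ({d : Fin D | a d ≠ 0}.ncard : ℝ)) ∧
    (∀ h : (Fin D → ℝ) → ℝ, ConvexOn ℝ Set.univ h →
      (∀ a : Fin D → ℝ, (⨆ d, |a d|) ≤ 1 → h a ≤ ({d : Fin D | a d ≠ 0}.ncard : ℝ)) →
      ∀ a : Fin D → ℝ, (⨆ d, |a d|) ≤ 1 → h a ≤ ∑ d, |a d|) := by
  simp only [iSup_abs_le_one_iff, ncard_ne_zero_eq_sum]
  refine ⟨fun a ha => Finset.sum_le_sum fun d _ => ?_, fun h hh hle a ha => ?_⟩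
  · split_ifs with hd
    · exact ha d
    · simp [not_not.1 hd]
  · refine hh.le_sum_abs_of_forall_notMem (fun b hb => ?_) Finset.univ a ha (by simp)
    refine (hle b fun d => ?_).trans_eq (Finset.sum_congr rfl fun d _ => ?_)
    · rcases hb d with hd | hd <;> simp [hd]
    · rcases hb d with hd | hd
      · simp [hd]
      · have hne : b d ≠ 0 := fun h0 => by simp [h0] at hd
        simp [hne, hd]
end

section
/- (Rademacher complexity bound for partition-wise linear models.) Let N, D, P ∈ ℕ with N ≥ 1, let λ_P ≥ 1 and λ_0 ≥ 1, and let x_1, …, x_N ∈ ℝ^D satisfy ‖x_n‖∞ ≤ 1 for all n. Let f_0 : ℝ^D → {0,1} be the constant function 1 and let f_1, …, f_P : ℝ^D → {0,1} be arbitrary. Let 𝒜 = {A ∈ ℝ^{D×(P+1)} : Ω(A) ≤ 1} where Ω(A) = λ_P Σ_{p=1}^P ‖a_p‖∞ + λ_0 Σ_{p=0}^P Σ_{d=1}^D |a_{dp}|. Then the empirical Rademacher complexity of the predictor class {g_A : A ∈ 𝒜} on x_1, …, x_N, namely (2/N)·2^{−N} Σ_{ε ∈ {−1,1}^N} sup_{A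 ∈ 𝒜} Σ_{n=1}^N ε_n g_A(x_n), is at most (2^{3/2}/√N)·(2 + √(ln(P + D(P+1)))). -/
/-- The partition-wise linear predictor `g_A(x) = Σ_{p=0}^P f_p(x)·⟨a_p, x⟩`. -/
noncomputable def pwPred (D P : ℕ) (f : Fin (P + 1) → (Fin D → ℝ) → ℝ)
    (A : Matrix (Fin D) (Fin (P + 1)) ℝ) (x : Fin D → ℝ) : ℝ :=
  ∑ p, f p x * ∑ d, A d p * x d

open Finset in
/-- The moment generating function bound for a Rademacher sum with coefficients in `[-1, 1]`. -/
theorem sum_exp_rademacher_le {N : ℕ} (b : Fin N → ℝ) (hb : ∀ n, |b n| ≤ 1) (t : ℝ) :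
    ∑ ε : Fin N → Bool, Real.exp (t * ∑ n, (if ε n then (1 : ℝ) else -1) * b n) ≤
      2 ^ N * Real.exp (t ^ 2 * N / 2) := by
  have hprod : ∑ ε : Fin N → Bool, Real.exp (t * ∑ n, (if ε n then (1 : ℝ) else -1) * b n) =
      ∏ n, ∑ s : Bool, Real.exp (t * ((if s then (1 : ℝ) else -1) * b n)) := by
    rw [prod_univ_sum, Fintype.piFinset_univ]
    refine sum_congr rfl fun ε _ => ?_
    rw [mul_sum, Real.exp_sum]
  have hfactor (n : Fin N) : ∑ s : Bool, Real.exp (t * ((if s then (1 : ℝ) else -1) * b n)) ≤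
      2 * Real.exp (t ^ 2 / 2) := by
    have hcosh := Real.cosh_le_exp_half_sq (t * b n)
    have hsq : (t * b n) ^ 2 / 2 ≤ t ^ 2 / 2 := by
      have : b n ^ 2 ≤ 1 := (sq_le_one_iff_abs_le_one _).2 (hb n)
      nlinarith [sq_nonneg t]
    have hexp := Real.exp_le_exp.2 hsq
    rw [Real.cosh_eq] at hcosh
    simp only [Fintype.sum_bool, if_true, Bool.false_eq_true, if_false, one_mul, neg_one_mul,
      mul_neg]
    linarith
  rw [hprod]
  calc _ ≤ ∏ _n : Fin N, 2 * Real.exp (t ^ 2 / 2) :=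
        prod_le_prod (fun n _ => by positivity) fun n _ => hfactor n
    _ = 2 ^ N * Real.exp (t ^ 2 * N / 2) := by
        rw [prod_const, card_univ, Fintype.card_fin, mul_pow, ← Real.exp_nat_mul]
        congr 2
        ring

/-- A tangent-line form of the soft-max bound. -/
theorem abs_le_softmax {J : Type*} [Fintype J] (Z : J → ℝ) {t c : ℝ} (ht : 0 < t) (hc : 0 < c)
    (j : J) :
    |Z j| ≤ (Real.log c - 1 + (∑ i, (Real.exp (t * Z i) + Real.exp (-t * Z i))) / c) / t := by
  have hexp : Real.exp (t * |Z j|) ≤ ∑ i, (Real.exp (t * Z i) + Real.exp (-t * Z i)) := by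
    refine le_trans ?_ (Finset.single_le_sum
      (f := fun i => Real.exp (t * Z i) + Real.exp (-t * Z i))
      (fun i _ => by positivity) (Finset.mem_univ j))
    have h₁ := Real.exp_pos (t * Z j)
    have h₂ := Real.exp_pos (-t * Z j)
    rcases abs_cases (Z j) with ⟨h, -⟩ | ⟨h, -⟩ <;> rw [h]
    · linarith
    · rw [mul_neg, ← neg_mul]
      linarith
  have htangent := Real.add_one_le_exp (t * |Z j| - Real.log c)
  rw [Real.exp_sub, Real.exp_log hc] at htangent
  have := div_le_div_of_nonneg_right hexp hc.le
  rw [le_div_iff₀ ht]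
  linarith

open Finset in
/-- Massart's finite class lemma for absolute values: a function of the signs that is dominated
by every common upper bound of the Rademacher sums `|∑ n, ε n * b j n|` has a small mean. -/
theorem massart_abs {N : ℕ} (hN : 1 ≤ N) {J : Type*} [Fintype J] [Nonempty J]
    (b : J → Fin N → ℝ) (hb : ∀ j n, |b j n| ≤ 1) (S : (Fin N → Bool) → ℝ)
    (hS : ∀ ε B, (∀ j, |∑ n, (if ε n then (1 : ℝ) else -1) * b j n| ≤ B) → S ε ≤ B) :
    (1 / 2 ^ N) * ∑ ε, S ε ≤ Real.sqrt (2 * N * Real.log (2 * Fintype.card J)) := by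
  have hN₀ : (0 : ℝ) < N := by exact_mod_cast hN
  have hM : (1 : ℝ) ≤ Fintype.card J := by exact_mod_cast Fintype.card_pos (α := J)
  have hL : 0 < Real.log (2 * Fintype.card J) := Real.log_pos (by linarith)
  set L := Real.log (2 * Fintype.card J) with hLdef
  set r := Real.sqrt (2 * N * L) with hr
  have hr₀ : 0 < r := Real.sqrt_pos.2 (by positivity)
  have hrsq : r ^ 2 = 2 * N * L := Real.sq_sqrt (by positivity)
  set t := r / N with ht
  have ht₀ : 0 < t := by positivity
  set c := 2 * Fintype.card J * Real.exp (t ^ 2 * N / 2) with hc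
  have hc₀ : 0 < c := by positivity
  have hlogc : Real.log c = L + t ^ 2 * N / 2 := by
    rw [hc, Real.log_mul (by positivity) (Real.exp_ne_zero _), Real.log_exp]
  let Z (ε : Fin N → Bool) (j : J) : ℝ := ∑ n, (if ε n then (1 : ℝ) else -1) * b j n
  have hmgf : ∑ ε, ∑ j, (Real.exp (t * Z ε j) + Real.exp (-t * Z ε j)) ≤ 2 ^ N * c := by
    rw [sum_comm]
    calc _ ≤ ∑ _j : J, 2 * (2 ^ N * Real.exp (t ^ 2 * N / 2)) := by
          refine sum_le_sum fun j _ => ?_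
          have h₁ := sum_exp_rademacher_le (b j) (hb j) t
          have h₂ := sum_exp_rademacher_le (b j) (hb j) (-t)
          rw [neg_sq] at h₂
          rw [sum_add_distrib]
          linarith
      _ = 2 ^ N * c := by
          rw [sum_const, card_univ, nsmul_eq_mul, hc]
          ring
  have hsum : ∑ ε, S ε ≤ 2 ^ N * (Real.log c / t) := by
    calc _ ≤ ∑ ε, (Real.log c - 1 +
            (∑ j, (Real.exp (t * Z ε j) + Real.exp (-t * Z ε j))) / c) / t :=
          sum_le_sum fun ε _ => hS ε _ fun j => abs_le_softmax (Z ε) ht₀ hc₀ j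
      _ = (2 ^ N * (Real.log c - 1) +
            (∑ ε, ∑ j, (Real.exp (t * Z ε j) + Real.exp (-t * Z ε j))) / c) / t := by
          rw [← sum_div, sum_add_distrib, ← sum_div]
          simp [mul_sub]
      _ ≤ (2 ^ N * (Real.log c - 1) + 2 ^ N * c / c) / t := by gcongr
      _ = 2 ^ N * (Real.log c / t) := by
          field_simp
          ring
  have hopt : Real.log c / t = r := by
    rw [hlogc, div_eq_iff ht₀.ne', ht]
    field_simp
    linarith
  rw [hopt] at hsum
  rw [one_div, inv_mul_le_iff₀ (by positivity)]
  exact hsum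

/-- The regularizer dominates the entrywise `ℓ¹` norm. -/
theorem sum_abs_le_Omega {D P : ℕ} {lamP lam0 : ℝ} (hlamP : 0 ≤ lamP) (hlam0 : 1 ≤ lam0)
    (A : Matrix (Fin D) (Fin (P + 1)) ℝ) :
    ∑ p, ∑ d, |A d p| ≤ Omega D P lamP lam0 A := by
  have hsup : 0 ≤ lamP * ∑ p : Fin P, (⨆ d, |A d p.succ|) :=
    mul_nonneg hlamP (Finset.sum_nonneg fun p _ => Real.iSup_nonneg fun d => abs_nonneg _)
  have hsum : 0 ≤ ∑ p, ∑ d, |A d p| := by positivity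
  unfold Omega
  nlinarith

open Finset in
/-- A signed sum of predictions is a linear form in the weights. -/
theorem sum_mul_pwPred {N D P : ℕ} (f : Fin (P + 1) → (Fin D → ℝ) → ℝ)
    (A : Matrix (Fin D) (Fin (P + 1)) ℝ) (x : Fin N → Fin D → ℝ) (w : Fin N → ℝ) :
    ∑ n, w n * pwPred D P f A (x n) =
      ∑ p, ∑ d, A d p * ∑ n, w n * (f p (x n) * x n d) := by
  simp only [pwPred, mul_sum]
  rw [sum_comm]
  refine sum_congr rfl fun p _ => ?_
  rw [sum_comm]
  refine sum_congr rfl fun d _ => sum_congr rfl fun n _ => ?_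
  ring

open Finset in
/-- Duality between the regularizer and the sup norm of the Rademacher sums. -/
theorem sum_mul_pwPred_le {N D P : ℕ} {lamP lam0 : ℝ} (hlamP : 0 ≤ lamP) (hlam0 : 1 ≤ lam0)
    (f : Fin (P + 1) → (Fin D → ℝ) → ℝ) (A : Matrix (Fin D) (Fin (P + 1)) ℝ)
    (hA : Omega D P lamP lam0 A ≤ 1) (x : Fin N → Fin D → ℝ) (w : Fin N → ℝ) {B : ℝ}
    (hB₀ : 0 ≤ B) (hB : ∀ p d, |∑ n, w n * (f p (x n) * x n d)| ≤ B) :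
    ∑ n, w n * pwPred D P f A (x n) ≤ B := by
  rw [sum_mul_pwPred]
  calc _ ≤ ∑ p, ∑ d, |A d p| * B := by
        refine sum_le_sum fun p _ => sum_le_sum fun d _ => (le_abs_self _).trans ?_
        rw [abs_mul]
        exact mul_le_mul_of_nonneg_left (hB p d) (abs_nonneg _)
    _ = (∑ p, ∑ d, |A d p|) * B := by simp only [sum_mul]
    _ ≤ B := mul_le_of_le_one_left hB₀ ((sum_abs_le_Omega hlamP hlam0 A).trans hA)

/-- Rademacher complexity bound for partition-wise linear models: the empirical
Rademacher complexity of `{g_A : Ω(A) ≤ 1}` on points with `‖x_n‖∞ ≤ 1` is at most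
`(2^{3/2}/√N)·(2 + √(ln(P + D(P+1))))`. -/
theorem rademacher_bound_partition_wise
    (N D P : ℕ) (hN : 1 ≤ N) (lamP lam0 : ℝ) (hlamP : 1 ≤ lamP) (hlam0 : 1 ≤ lam0)
    (x : Fin N → Fin D → ℝ) (hx : ∀ n, (⨆ d, |x n d|) ≤ 1)
    (f : Fin (P + 1) → (Fin D → ℝ) → ℝ)
    (hf0 : ∀ z, f 0 z = 1)
    (hf01 : ∀ p z, f p z = 0 ∨ f p z = 1) :
    (2 / (N : ℝ)) * ((1 / 2 ^ N) * ∑ ε : Fin N → Bool,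
        sSup {s : ℝ | ∃ A : Matrix (Fin D) (Fin (P + 1)) ℝ,
          Omega D P lamP lam0 A ≤ 1 ∧
          s = ∑ n, (if ε n then (1 : ℝ) else -1) * pwPred D P f A (x n)}) ≤
      (2 ^ ((3 : ℝ) / 2) / Real.sqrt N) *
        (2 + Real.sqrt (Real.log ((P : ℝ) + (D : ℝ) * ((P : ℝ) + 1)))) := by
  have hN₀ : (0 : ℝ) < N := by exact_mod_cast hN
  have hrhs : 0 ≤ (2 ^ ((3 : ℝ) / 2) / Real.sqrt N) *
      (2 + Real.sqrt (Real.log ((P : ℝ) + (D : ℝ) * ((P : ℝ) + 1)))) := by positivity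
  have hsup_le (ε : Fin N → Bool) (B : ℝ) (hB₀ : 0 ≤ B)
      (hB : ∀ p d, |∑ n, (if ε n then (1 : ℝ) else -1) * (f p (x n) * x n d)| ≤ B) :
      sSup {s : ℝ | ∃ A : Matrix (Fin D) (Fin (P + 1)) ℝ,
        Omega D P lamP lam0 A ≤ 1 ∧
        s = ∑ n, (if ε n then (1 : ℝ) else -1) * pwPred D P f A (x n)} ≤ B := by
    refine Real.sSup_le ?_ hB₀
    rintro s ⟨A, hA, rfl⟩
    exact sum_mul_pwPred_le (by linarith) hlam0 f A hA x _ hB₀ hB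
  rcases Nat.eq_zero_or_pos D with rfl | hD
  · refine le_trans ?_ hrhs
    exact mul_nonpos_of_nonneg_of_nonpos (by positivity)
      (mul_nonpos_of_nonneg_of_nonpos (by positivity)
        (Finset.sum_nonpos fun ε _ => hsup_le ε 0 le_rfl fun _ d => d.elim0))
  have : Nonempty (Fin D) := ⟨⟨0, hD⟩⟩
  have hb (j : Fin (P + 1) × Fin D) (n : Fin N) : |f j.1 (x n) * x n j.2| ≤ 1 := by
    have hxd : |x n j.2| ≤ 1 :=
      (le_ciSup (f := fun d => |x n d|) (Set.finite_range _).bddAbove j.2).trans (hx n)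
    rcases hf01 j.1 (x n) with h | h <;> simp [h, hxd]
  have hmassart := massart_abs hN (fun (j : Fin (P + 1) × Fin D) n => f j.1 (x n) * x n j.2) hb _
    fun ε B hB => hsup_le ε B ((abs_nonneg _).trans (hB (Classical.arbitrary _)))
      fun p d => hB (p, d)
  have hcard : (Fintype.card (Fin (P + 1) × Fin D) : ℝ) = D * (P + 1) := by
    simp [mul_comm]
  rw [hcard] at hmassart
  have hM : (1 : ℝ) ≤ D * (P + 1) := by
    rw [← hcard]
    exact_mod_cast Fintype.card_pos (α := Fin (P + 1) × Fin D)
  have hlog : Real.sqrt (Real.log (2 * (D * (P + 1)))) ≤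
      2 + Real.sqrt (Real.log ((P : ℝ) + (D : ℝ) * ((P : ℝ) + 1))) := by
    have hP : (0 : ℝ) ≤ P := P.cast_nonneg
    have hmono : Real.log (D * (P + 1)) ≤ Real.log ((P : ℝ) + (D : ℝ) * ((P : ℝ) + 1)) :=
      Real.log_le_log (by linarith) (by linarith)
    have hlog₀ := (Real.log_nonneg hM).trans hmono
    rw [Real.log_mul two_ne_zero (by linarith)]
    refine Real.sqrt_le_iff.2 ⟨by positivity, ?_⟩
    nlinarith [Real.sq_sqrt hlog₀, Real.sqrt_nonneg (Real.log (P + D * ((P : ℝ) + 1))),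
      Real.log_two_lt_d9]
  have htwo : (2 : ℝ) ^ ((3 : ℝ) / 2) = 2 * Real.sqrt 2 := by
    rw [show (3 : ℝ) / 2 = 1 + 1 / 2 by norm_num, Real.rpow_add two_pos, Real.rpow_one,
      Real.sqrt_eq_rpow]
  calc _ ≤ 2 / (N : ℝ) * Real.sqrt (2 * N * Real.log (2 * (D * (P + 1)))) :=
        mul_le_mul_of_nonneg_left hmassart (by positivity)
    _ = (2 ^ ((3 : ℝ) / 2) / Real.sqrt N) * Real.sqrt (Real.log (2 * (D * (P + 1)))) := by
        rw [Real.sqrt_mul (by positivity), Real.sqrt_mul zero_le_two, htwo]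
        have hsq : Real.sqrt N ^ 2 = N := Real.sq_sqrt hN₀.le
        have : 0 < Real.sqrt N := Real.sqrt_pos.2 hN₀
        field_simp
        rw [hsq]
    _ ≤ _ := mul_le_mul_of_nonneg_left hlog (by positivity)
end

section
/- (Generalization bound for the global and local residual model.) Let N, D, P ∈ ℕ with N ≥ 1, let λ_P ≥ 1 and λ_0 ≥ 1, let L > 0 and δ ∈ (0,1). Let Y be a measurable space, let 𝒟 be a probability distribution on X × Y where X = {x ∈ ℝ^D : ‖x‖∞ ≤ 1}, and let ℓ : Y × ℝ → [0,1] be measurable and L-Lipschitz in its second argument. Let f_0 ≡ 1 and f_1, …, f_P : ℝ^D → {0,1} be measurable activeness functions, and let 𝒜 = {A ∈ ℝ^{D×(P+1)} : Ω(A) ≤ 1}, where Ω(A) = λ_P Σ_{p=1}^P ‖a_p‖∞ + λ_0 Σ_{p=0}^P Σ_{d=1}^D |a_{dp}|. Then, with probability at least 1 − δ over an i.i.d. sample (x_1,y_1), …, (x_N,y_N) drawn from 𝒟, simultaneously for every A ∈ 𝒜: E_{(x,y)∼𝒟}[ℓ(y, g_A(x))] ≤ (1/N) Σ_{n=1}^N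 ℓ(y_n, g_A(x_n)) + (2^{3/2} L/√N)·(2 + √(ln(DP + P + D))) + √(ln(1/δ)/(2N)). -/
open MeasureTheory

open ProbabilityTheory in
/-- **McDiarmid's inequality**, moment generating function form. -/
theorem hasSubgaussianMGF_of_bounded_differences {Z : Type*} [MeasurableSpace Z] (μ : Measure Z)
    [IsProbabilityMeasure μ] {c : ℝ} (n : ℕ) (F : (Fin n → Z) → ℝ)
    (hF : Measurable F) {C : ℝ} (hC : ∀ S, |F S| ≤ C)
    (hdiff : ∀ i S S', (∀ j, j ≠ i → S j = S' j) → |F S - F S'| ≤ c) :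
    HasSubgaussianMGF (fun S ↦ F S - ∫ S, F S ∂(Measure.pi fun _ : Fin n ↦ μ))
      (n * (‖c‖₊ / 2) ^ 2) (Measure.pi fun _ : Fin n ↦ μ) := by
  induction n with
  | zero =>
    have h : ∀ S, F S - ∫ S, F S ∂(Measure.pi fun _ : Fin 0 ↦ μ) = 0 := by
      intro S
      have : F = fun _ ↦ F S := by
        funext S'
        rw [Subsingleton.elim S' S]
      rw [this]
      simp
    simp only [h]
    simp
  | succ n ih =>
    set π := Measure.pi fun _ : Fin n ↦ μ
    have hcons : Measurable fun q : Z × (Fin n → Z) ↦ (Fin.cons q.1 q.2 : Fin (n + 1) → Z) := by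
      refine measurable_pi_iff.2 fun i ↦ ?_
      refine Fin.cases ?_ (fun j ↦ ?_) i
      · simpa using measurable_fst
      · simpa [Function.comp_def] using (measurable_pi_apply j).comp measurable_snd
    have hmp : MeasurePreserving
        (fun q : Z × (Fin n → Z) ↦ (Fin.cons q.1 q.2 : Fin (n + 1) → Z)) (μ.prod π)
        (Measure.pi fun _ : Fin (n + 1) ↦ μ) := by
      have h := (measurePreserving_piFinSuccAbove (fun _ : Fin (n + 1) ↦ μ) 0).symm
      convert h using 1
      funext q
      simp [MeasurableEquiv.piFinSuccAbove]
      rfl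
    have hFc : Measurable fun q : Z × (Fin n → Z) ↦ F (Fin.cons q.1 q.2) := hF.comp hcons
    have htransfer : ∀ φ : ℝ → ℝ, Measurable φ →
        ∫ S, φ (F S) ∂(Measure.pi fun _ : Fin (n + 1) ↦ μ)
          = ∫ q, φ (F (Fin.cons q.1 q.2)) ∂(μ.prod π) := by
      intro φ hφ
      rw [← hmp.map_eq, integral_map hmp.measurable.aemeasurable]
      exact (hφ.comp hF).aestronglyMeasurable
    have hint : Integrable (fun q : Z × (Fin n → Z) ↦ F (Fin.cons q.1 q.2)) (μ.prod π) :=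
      Integrable.of_mem_Icc (-C) C hFc.aemeasurable
        (Filter.Eventually.of_forall fun q ↦ abs_le.1 (hC _))
    set G : (Fin n → Z) → ℝ := fun S ↦ ∫ z, F (Fin.cons z S) ∂μ with hG
    have hsec : ∀ S, Measurable fun z ↦ F (Fin.cons z S) := fun S ↦
      hFc.comp measurable_prodMk_right
    have hsecint : ∀ S, Integrable (fun z ↦ F (Fin.cons z S)) μ := fun S ↦
      Integrable.of_mem_Icc (-C) C (hsec S).aemeasurable
        (Filter.Eventually.of_forall fun q ↦ abs_le.1 (hC _))
    have hGm : Measurable G :=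
      (hFc.stronglyMeasurable.integral_prod_left').measurable
    have hmean : ∫ S, F S ∂(Measure.pi fun _ : Fin (n + 1) ↦ μ) = ∫ S, G S ∂π := by
      rw [htransfer (fun x ↦ x) measurable_id, integral_prod_symm _ hint]
    have hGC : ∀ S, |G S| ≤ C := fun S ↦ by
      have := norm_integral_le_of_norm_le_const (μ := μ) (f := fun z ↦ F (Fin.cons z S)) (C := C)
        (Filter.Eventually.of_forall fun z ↦ hC _)
      simpa using this
    have hGdiff : ∀ i S S', (∀ j, j ≠ i → S j = S' j) → |G S - G S'| ≤ c := by
      intro i S S' h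
      have h1 : G S - G S' = ∫ z, (F (Fin.cons z S) - F (Fin.cons z S')) ∂μ :=
        (integral_sub (hsecint S) (hsecint S')).symm
      rw [h1]
      have := norm_integral_le_of_norm_le_const (μ := μ)
        (f := fun z ↦ F (Fin.cons z S) - F (Fin.cons z S')) (C := c)
        (Filter.Eventually.of_forall fun z ↦ by
          refine hdiff i.succ _ _ fun j ↦ ?_
          refine Fin.cases ?_ (fun j hj ↦ ?_) j
          · simp
          · simpa using h j (fun hh ↦ hj (by rw [hh])))
      simpa using this
    have ihG := ih G hGm hGC hGdiff
    set m := ∫ S, G S ∂π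
    have hfib : ∀ S t, ∫ z, Real.exp (t * (F (Fin.cons z S) - G S)) ∂μ
        ≤ Real.exp (((‖c‖₊ / 2) ^ 2 : NNReal) * t ^ 2 / 2) := by
      intro S t
      have hbdd : BddBelow (Set.range fun z ↦ F (Fin.cons z S)) :=
        ⟨-C, by rintro _ ⟨z, rfl⟩; exact (abs_le.1 (hC _)).1⟩
      have hne : Nonempty Z := nonempty_of_isProbabilityMeasure μ
      have h := hasSubgaussianMGF_of_mem_Icc (μ := μ) (X := fun z ↦ F (Fin.cons z S))
        (a := ⨅ z, F (Fin.cons z S)) (b := (⨅ z, F (Fin.cons z S)) + c) (hsec S).aemeasurable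
        (Filter.Eventually.of_forall fun z ↦ ⟨ciInf_le hbdd z, by
          have : F (Fin.cons z S) - c ≤ ⨅ z, F (Fin.cons z S) := by
            refine le_ciInf fun z' ↦ ?_
            have := hdiff 0 (Fin.cons z S) (Fin.cons z' S) (fun j ↦ by
              refine Fin.cases (by simp) (fun j _ ↦ by simp) j)
            linarith [(abs_le.1 this).2]
          linarith⟩)
      have h2 := h.mgf_le t
      simpa [mgf, hG] using h2
    refine ⟨fun t ↦ ?_, fun t ↦ ?_⟩
    · refine integrable_exp_mul_of_mem_Icc (a := -C - m) (b := C - m)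
        (hF.sub_const _).aemeasurable (Filter.Eventually.of_forall fun S ↦ ?_)
      have := abs_le.1 (hC S)
      rw [hmean]
      exact ⟨by linarith, by linarith⟩
    · have hexpint : Integrable (fun q : Z × (Fin n → Z) ↦
          Real.exp (t * (F (Fin.cons q.1 q.2) - m))) (μ.prod π) :=
        integrable_exp_mul_of_mem_Icc (a := -C - m) (b := C - m)
          (hFc.sub_const _).aemeasurable (Filter.Eventually.of_forall fun q ↦ by
            have := abs_le.1 (hC (Fin.cons q.1 q.2))
            exact ⟨by linarith, by linarith⟩)
      rw [mgf, hmean, htransfer (fun x ↦ Real.exp (t * (x - m))) (by fun_prop),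
        integral_prod_symm _ hexpint]
      have hsplit : ∀ S, ∫ z, Real.exp (t * (F (Fin.cons z S) - m)) ∂μ
          ≤ Real.exp (t * (G S - m)) * Real.exp (((‖c‖₊ / 2) ^ 2 : NNReal) * t ^ 2 / 2) := by
        intro S
        have : ∀ z, Real.exp (t * (F (Fin.cons z S) - m))
            = Real.exp (t * (G S - m)) * Real.exp (t * (F (Fin.cons z S) - G S)) := by
          intro z
          rw [← Real.exp_add]
          ring_nf
        simp_rw [this]
        rw [integral_const_mul]
        gcongr
        exact hfib S t
      calc _ ≤ ∫ S, Real.exp (t * (G S - m))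
              * Real.exp (((‖c‖₊ / 2) ^ 2 : NNReal) * t ^ 2 / 2) ∂π :=
            integral_mono hexpint.integral_prod_right
              ((ihG.integrable_exp_mul t).mul_const _) hsplit
        _ ≤ Real.exp ((n * (‖c‖₊ / 2) ^ 2 : NNReal) * t ^ 2 / 2)
              * Real.exp (((‖c‖₊ / 2) ^ 2 : NNReal) * t ^ 2 / 2) := by
            rw [integral_mul_const]
            gcongr
            exact ihG.mgf_le t
        _ = _ := by
            rw [← Real.exp_add]
            push_cast
            ring_nf

theorem ciSup_add_ciSup_sub_le_of_abs_sub_le {ι : Type*} [Finite ι] [Nonempty ι] (u φ ψ : ι → ℝ)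
    (h : ∀ a b, |φ a - φ b| ≤ |ψ a - ψ b|) :
    (⨆ a, (u a + φ a)) + (⨆ a, (u a - φ a)) ≤ (⨆ a, (u a + ψ a)) + ⨆ a, (u a - ψ a) := by
  obtain ⟨a, ha⟩ := exists_eq_ciSup_of_finite (f := fun a ↦ u a + φ a)
  obtain ⟨b, hb⟩ := exists_eq_ciSup_of_finite (f := fun a ↦ u a - φ a)
  rw [← ha, ← hb]
  have hp : ∀ x, u x + ψ x ≤ ⨆ a, (u a + ψ a) := le_ciSup (Finite.bddAbove_range _)
  have hm : ∀ x, u x - ψ x ≤ ⨆ a, (u a - ψ a) := le_ciSup (Finite.bddAbove_range _)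
  have h1 := (le_abs_self _).trans (h a b)
  rcases abs_cases (ψ a - ψ b) with ⟨h2, -⟩ | ⟨h2, -⟩
  · linarith [hp a, hm b]
  · linarith [hp b, hm a]

theorem sum_units_fin_succ {n : ℕ} (g : (Fin (n + 1) → ℤˣ) → ℝ) :
    ∑ σ, g σ = ∑ σ : Fin n → ℤˣ, (g (Fin.cons 1 σ) + g (Fin.cons (-1) σ)) := by
  rw [← (Fin.consEquiv fun _ ↦ ℤˣ).sum_comp, Fintype.sum_prod_type, UnitsInt.univ,
    Finset.sum_pair (by decide), ← Finset.sum_add_distrib]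
  rfl

/-- The **Ledoux–Talagrand contraction principle** for Rademacher sums over a finite class. -/
theorem sum_ciSup_rademacher_contraction {ι : Type*} [Finite ι] [Nonempty ι] (n : ℕ) (u : ι → ℝ)
    (φ ψ : Fin n → ι → ℝ) (h : ∀ i a b, |φ i a - φ i b| ≤ |ψ i a - ψ i b|) :
    ∑ σ : Fin n → ℤˣ, ⨆ a, (u a + ∑ i, ((σ i : ℤ) : ℝ) * φ i a)
      ≤ ∑ σ : Fin n → ℤˣ, ⨆ a, (u a + ∑ i, ((σ i : ℤ) : ℝ) * ψ i a) := by
  induction n generalizing u with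
  | zero => simp
  | succ n ih =>
    rw [sum_units_fin_succ, sum_units_fin_succ, Finset.sum_add_distrib]
    have hp := ih (fun a ↦ u a + φ 0 a) (fun i ↦ φ i.succ) (fun i ↦ ψ i.succ) fun i ↦ h i.succ
    have hm := ih (fun a ↦ u a - φ 0 a) (fun i ↦ φ i.succ) (fun i ↦ ψ i.succ) fun i ↦ h i.succ
    simp only [Fin.sum_univ_succ, Fin.cons_zero, Fin.cons_succ, Units.val_one, Units.val_neg,
      Int.cast_one, Int.cast_neg, one_mul, neg_one_mul, ← add_assoc, ← sub_eq_add_neg]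
    refine (add_le_add hp hm).trans ?_
    rw [← Finset.sum_add_distrib]
    refine Finset.sum_le_sum fun σ _ ↦ ?_
    have := ciSup_add_ciSup_sub_le_of_abs_sub_le
      (fun a ↦ u a + ∑ i, ((σ i : ℤ) : ℝ) * ψ i.succ a) (φ 0) (ψ 0) (h 0)
    simp only [add_right_comm, sub_eq_add_neg] at this ⊢
    exact this

theorem sum_exp_rademacher_le_s12 {n : ℕ} (v : Fin n → ℝ) (hv : ∀ i, |v i| ≤ 1) (t : ℝ) :
    ∑ σ : Fin n → ℤˣ, Real.exp (t * ∑ i, ((σ i : ℤ) : ℝ) * v i)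
      ≤ 2 ^ n * Real.exp (n * t ^ 2 / 2) := by
  have h1 : ∀ σ : Fin n → ℤˣ, Real.exp (t * ∑ i, ((σ i : ℤ) : ℝ) * v i)
      = ∏ i, Real.exp (t * (((σ i : ℤ) : ℝ) * v i)) := fun σ ↦ by
    rw [Finset.mul_sum, Real.exp_sum]
  have h2 : ∀ i, ∑ s : ℤˣ, Real.exp (t * (((s : ℤ) : ℝ) * v i)) = 2 * Real.cosh (t * v i) := by
    intro i
    rw [UnitsInt.univ, Finset.sum_pair (by decide), Real.cosh_eq]
    simp
    ring
  simp_rw [h1]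
  rw [← Fintype.prod_sum fun i (s : ℤˣ) ↦ Real.exp (t * (((s : ℤ) : ℝ) * v i))]
  simp_rw [h2]
  rw [Finset.prod_mul_distrib]
  simp only [Finset.prod_const, Finset.card_univ, Fintype.card_fin]
  gcongr
  calc ∏ i, Real.cosh (t * v i) ≤ ∏ _i : Fin n, Real.exp (t ^ 2 / 2) := by
        refine Finset.prod_le_prod (fun i _ ↦ (Real.cosh_pos _).le) fun i _ ↦ ?_
        refine (Real.cosh_le_exp_half_sq _).trans (Real.exp_le_exp.2 ?_)
        have : v i ^ 2 ≤ 1 := (sq_le_one_iff_abs_le_one _).2 (hv i)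
        nlinarith [sq_nonneg t]
    _ = Real.exp (n * t ^ 2 / 2) := by
        rw [Finset.prod_const, ← Real.exp_nat_mul, Finset.card_univ, Fintype.card_fin]
        ring_nf

/-- **Massart's lemma** for an `ℓ¹`-bounded class of combinations of vectors bounded by one. -/
theorem sum_ciSup_rademacher_le_of_sum_abs_le_one {ι J : Type*} [Finite ι] [Nonempty ι]
    [Fintype J] {n : ℕ} (w : ι → J → ℝ) (hw : ∀ a, ∑ j, |w a j| ≤ 1) (v : J → Fin n → ℝ)
    (hv : ∀ j i, |v j i| ≤ 1) {q : ℝ} (hq : 0 < q)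
    (hcard : Real.log (1 + 2 * Fintype.card J) ≤ q ^ 2) :
    ∑ σ : Fin n → ℤˣ, ⨆ a, ∑ i, ((σ i : ℤ) : ℝ) * ∑ j, w a j * v j i
      ≤ 2 ^ n * (q * Real.sqrt (2 * n)) := by
  rcases Nat.eq_zero_or_pos n with rfl | hn
  · simp
  have hn' : (0 : ℝ) < n := by exact_mod_cast hn
  set s : J → (Fin n → ℤˣ) → ℝ := fun j σ ↦ ∑ i, ((σ i : ℤ) : ℝ) * v j i with hs
  set M : ℝ := (Fintype.card J : ℝ) with hM
  have hM0 : 0 ≤ M := Nat.cast_nonneg _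
  set t : ℝ := q * Real.sqrt (2 / n) with ht
  have htpos : 0 < t := by positivity
  set W : (Fin n → ℤˣ) → ℝ :=
    fun σ ↦ 1 + ∑ j, (Real.exp (t * s j σ) + Real.exp (-t * s j σ)) with hW
  have hW1 : ∀ σ, 1 ≤ W σ := fun σ ↦ le_add_of_nonneg_right (by positivity)
  have hsup : ∀ σ : Fin n → ℤˣ, (⨆ a, ∑ i, ((σ i : ℤ) : ℝ) * ∑ j, w a j * v j i)
      ≤ Real.log (W σ) / t := by
    intro σ
    refine ciSup_le fun a ↦ ?_
    rw [le_div_iff₀ htpos]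
    have hlog0 : 0 ≤ Real.log (W σ) := Real.log_nonneg (hW1 σ)
    have hj : ∀ j, |s j σ| * t ≤ Real.log (W σ) := by
      intro j
      have hterm : Real.exp (t * s j σ) + Real.exp (-t * s j σ) ≤ W σ := by
        have := Finset.single_le_sum
          (f := fun j ↦ Real.exp (t * s j σ) + Real.exp (-t * s j σ))
          (fun j _ ↦ by positivity) (Finset.mem_univ j)
        simp only [hW]
        linarith
      rw [Real.le_log_iff_exp_le (by linarith [hW1 σ])]
      rcases abs_cases (s j σ) with ⟨h, -⟩ | ⟨h, -⟩
      · rw [h, mul_comm]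
        linarith [Real.exp_pos (-t * s j σ)]
      · rw [h, show -s j σ * t = -t * s j σ by ring]
        linarith [Real.exp_pos (t * s j σ)]
    have hswap : ∑ i, ((σ i : ℤ) : ℝ) * ∑ j, w a j * v j i = ∑ j, w a j * s j σ := by
      simp only [hs, Finset.mul_sum]
      rw [Finset.sum_comm]
      refine Finset.sum_congr rfl fun j _ ↦ Finset.sum_congr rfl fun i _ ↦ by ring
    rw [hswap, Finset.sum_mul]
    calc ∑ j, w a j * s j σ * t ≤ ∑ j, |w a j| * Real.log (W σ) := by
          refine Finset.sum_le_sum fun j _ ↦ ?_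
          calc w a j * s j σ * t ≤ |w a j * s j σ| * t := by gcongr; exact le_abs_self _
            _ = |w a j| * (|s j σ| * t) := by rw [abs_mul]; ring
            _ ≤ _ := by gcongr; exact hj j
      _ = (∑ j, |w a j|) * Real.log (W σ) := by rw [Finset.sum_mul]
      _ ≤ 1 * Real.log (W σ) := by gcongr; exact hw a
      _ = _ := one_mul _
  have hWsum : ∑ σ, W σ ≤ 2 ^ n * ((1 + 2 * M) * Real.exp (n * t ^ 2 / 2)) := by
    have hcardσ : (Fintype.card (Fin n → ℤˣ) : ℝ) = 2 ^ n := by simp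
    simp only [hW, Finset.sum_add_distrib]
    rw [Finset.sum_comm (f := fun σ j ↦ Real.exp (t * s j σ)),
      Finset.sum_comm (f := fun σ j ↦ Real.exp (-t * s j σ))]
    have h1 : ∀ r : ℝ, ∑ j, ∑ σ, Real.exp (r * s j σ)
        ≤ M * (2 ^ n * Real.exp (n * r ^ 2 / 2)) := by
      intro r
      refine (Finset.sum_le_sum fun j _ ↦ sum_exp_rademacher_le_s12 (v j) (hv j) r).trans_eq ?_
      simp [hM]
    have h2 := h1 t
    have h3 := h1 (-t)
    rw [neg_sq] at h3
    have h4 : (1 : ℝ) ≤ Real.exp (n * t ^ 2 / 2) := Real.one_le_exp (by positivity)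
    have h5 : (2 : ℝ) ^ n * 1 ≤ 2 ^ n * Real.exp (n * t ^ 2 / 2) := by gcongr
    have h6 : ∑ _σ : Fin n → ℤˣ, (1 : ℝ) = 2 ^ n := by
      rw [← hcardσ]; simp
    rw [h6]
    linarith
  have hjensen : ∑ σ, Real.log (W σ)
      ≤ 2 ^ n * Real.log ((1 + 2 * M) * Real.exp (n * t ^ 2 / 2)) := by
    have hj := strictConcaveOn_log_Ioi.concaveOn.le_map_sum (t := Finset.univ)
      (w := fun _ : Fin n → ℤˣ ↦ ((2 : ℝ) ^ n)⁻¹) (p := W) (fun _ _ ↦ by positivity)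
      (by simp) (fun σ _ ↦ Set.mem_Ioi.2 (by linarith [hW1 σ]))
    simp only [smul_eq_mul, ← Finset.mul_sum] at hj
    rw [inv_mul_le_iff₀ (by positivity)] at hj
    refine hj.trans (mul_le_mul_of_nonneg_left (Real.log_le_log ?_ ?_) (by positivity))
    · have : 0 < ∑ σ, W σ :=
        Finset.sum_pos (fun σ _ ↦ by linarith [hW1 σ]) Finset.univ_nonempty
      positivity
    · rw [inv_mul_le_iff₀ (by positivity)]
      exact hWsum
  rw [Real.log_mul (by positivity) (Real.exp_pos _).ne', Real.log_exp] at hjensen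
  have hopt : (q ^ 2 + n * t ^ 2 / 2) / t = q * Real.sqrt (2 * n) := by
    have e1 : t * Real.sqrt (2 * n) = 2 * q := by
      rw [ht, mul_assoc, ← Real.sqrt_mul (by positivity),
        show (2 : ℝ) / n * (2 * n) = 2 ^ 2 by field_simp,
        Real.sqrt_sq (by norm_num)]
      ring
    have e2 : n * t ^ 2 = 2 * q ^ 2 := by
      rw [ht, mul_pow, Real.sq_sqrt (by positivity)]
      field_simp
    rw [div_eq_iff htpos.ne', e2]
    linear_combination (-q) * e1
  calc _ ≤ ∑ σ, Real.log (W σ) / t := Finset.sum_le_sum fun σ _ ↦ hsup σ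
    _ = (∑ σ, Real.log (W σ)) / t := by rw [Finset.sum_div]
    _ ≤ (2 ^ n * (q ^ 2 + n * t ^ 2 / 2)) / t := by
        gcongr
        refine hjensen.trans ?_
        gcongr
    _ = _ := by rw [mul_div_assoc, hopt]

/-- **Symmetrization**: an almost sure bound on the Rademacher sums of a finite class bounds the
expected supremum of its centred empirical sums. -/
theorem integral_ciSup_sum_integral_sub_le {ι Z : Type*} [Finite ι] [Nonempty ι]
    [MeasurableSpace Z] (μ : Measure Z) [IsProbabilityMeasure μ] {n : ℕ} (h : ι → Z → ℝ)
    (hm : ∀ a, Measurable (h a)) (hr : ∀ a z, h a z ∈ Set.Icc (0 : ℝ) 1) {p : Z → Prop}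
    (hp : ∀ᵐ z ∂μ, p z) {B : ℝ}
    (hpos : ∀ S : Fin n → Z, (∀ i, p (S i)) →
      ∑ σ : Fin n → ℤˣ, ⨆ a, ∑ i, ((σ i : ℤ) : ℝ) * h a (S i) ≤ 2 ^ n * B)
    (hneg : ∀ S : Fin n → Z, (∀ i, p (S i)) →
      ∑ σ : Fin n → ℤˣ, ⨆ a, ∑ i, ((σ i : ℤ) : ℝ) * -h a (S i) ≤ 2 ^ n * B) :
    ∫ S, ⨆ a, ∑ i, ((∫ z, h a z ∂μ) - h a (S i)) ∂(Measure.pi fun _ : Fin n ↦ μ) ≤ 2 * B := by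
  set π := Measure.pi fun _ : Fin n ↦ μ
  set ρ := Measure.pi fun _ : Fin n ↦ μ.prod μ
  set w : (Fin n → Z × Z) → ℝ := fun T ↦ ⨆ a, ∑ i, (h a (T i).1 - h a (T i).2)
  have hterm : ∀ a z z', |h a z - h a z'| ≤ 1 := fun a z z' ↦ by
    have h1 := hr a z
    have h2 := hr a z'
    exact abs_le.2 ⟨by linarith [h1.1, h2.2], by linarith [h1.2, h2.1]⟩
  have hbound : ∀ g : ι → Fin n → ℝ, (∀ a i, |g a i| ≤ 1) →
      (⨆ a, ∑ i, g a i) ∈ Set.Icc (-n : ℝ) n := by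
    intro g hg
    have habs : ∀ a, |∑ i, g a i| ≤ n := fun a ↦
      (Finset.abs_sum_le_sum_abs _ _).trans
        ((Finset.sum_le_sum fun i _ ↦ hg a i).trans_eq (by simp))
    obtain ⟨a, ha⟩ := exists_eq_ciSup_of_finite (f := fun a ↦ ∑ i, g a i)
    rw [← ha]
    exact abs_le.1 (habs a)
  have hwm : Measurable w := by
    refine Measurable.iSup fun a ↦ Finset.measurable_fun_sum _ fun i _ ↦ ?_
    have := hm a
    fun_prop
  have hwr : ∀ T, w T ∈ Set.Icc (-n : ℝ) n := fun T ↦ hbound _ fun a i ↦ hterm a _ _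
  have hwint : Integrable w ρ :=
    Integrable.of_mem_Icc _ _ hwm.aemeasurable (Filter.Eventually.of_forall hwr)
  have hzip := (measurePreserving_arrowProdEquivProdArrow Z Z (Fin n) (fun _ ↦ μ)
    fun _ ↦ μ).symm
  have hzint : Integrable (fun q : (Fin n → Z) × (Fin n → Z) ↦ w fun i ↦ (q.1 i, q.2 i))
      (π.prod π) := hzip.integrable_comp_of_integrable hwint
  have hzw : ∫ q : (Fin n → Z) × (Fin n → Z), w (fun i ↦ (q.1 i, q.2 i)) ∂(π.prod π)
      = ∫ T, w T ∂ρ :=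
    hzip.integral_comp (MeasurableEquiv.measurableEmbedding _) w
  have hIh : ∀ a, Integrable (h a) μ := fun a ↦
    Integrable.of_mem_Icc 0 1 (hm a).aemeasurable (Filter.Eventually.of_forall (hr a))
  have hmean : ∀ a, (∫ z, h a z ∂μ) ∈ Set.Icc (0 : ℝ) 1 := fun a ↦
    ⟨integral_nonneg fun z ↦ (hr a z).1, by
      simpa using integral_mono (hIh a) (integrable_const (1 : ℝ)) fun z ↦ (hr a z).2⟩
  have hghost : ∫ S, ⨆ a, ∑ i, ((∫ z, h a z ∂μ) - h a (S i)) ∂π ≤ ∫ T, w T ∂ρ := by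
    rw [← hzw, integral_prod_symm _ hzint]
    refine integral_mono ?_ hzint.integral_prod_right fun S ↦ ciSup_le fun a ↦ ?_
    · refine Integrable.of_mem_Icc (-n) n (Measurable.aemeasurable ?_)
        (Filter.Eventually.of_forall fun S ↦ hbound _ fun a i ↦ ?_)
      · refine Measurable.iSup fun a ↦ Finset.measurable_fun_sum _ fun i _ ↦ ?_
        have := hm a
        fun_prop
      · have h1 := hmean a
        have h2 := hr a (S i)
        exact abs_le.2 ⟨by linarith [h1.1, h2.2], by linarith [h1.2, h2.1]⟩
    · have hev : ∀ i, ∫ z, h a z ∂μ = ∫ S' : Fin n → Z, h a (S' i) ∂π := fun i ↦ by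
        have := measurePreserving_eval (fun _ : Fin n ↦ μ) i
        conv_lhs => rw [← this.map_eq]
        rw [integral_map this.measurable.aemeasurable (hm a).aestronglyMeasurable]
      have hint : ∀ i, Integrable (fun S' : Fin n → Z ↦ h a (S' i)) π := fun i ↦
        (measurePreserving_eval (fun _ : Fin n ↦ μ) i).integrable_comp_of_integrable (hIh a)
      have hsub : ∀ i, Integrable (fun S' : Fin n → Z ↦ h a (S' i) - h a (S i)) π := fun i ↦
        (hint i).sub (integrable_const _)
      have heq : ∑ i, ((∫ z, h a z ∂μ) - h a (S i))
          = ∫ S' : Fin n → Z, ∑ i, (h a (S' i) - h a (S i)) ∂π := by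
        rw [integral_finsetSum _ fun i _ ↦ hsub i]
        refine Finset.sum_congr rfl fun i _ ↦ ?_
        rw [integral_sub (hint i) (integrable_const _), ← hev i]
        simp
      rw [heq]
      refine integral_mono (integrable_finsetSum _ fun i _ ↦ hsub i) ?_ fun S' ↦ ?_
      · refine Integrable.of_mem_Icc (-n) n (Measurable.aemeasurable ?_)
          (Filter.Eventually.of_forall fun S' ↦ hwr _)
        exact hwm.comp (by fun_prop)
      · exact le_ciSup (f := fun a ↦ ∑ i, (h a (S' i) - h a (S i))) (Finite.bddAbove_range _) a
  let swap : (Fin n → ℤˣ) → (Fin n → Z × Z) → Fin n → Z × Z :=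
    fun σ T i ↦ (if σ i = 1 then id else Prod.swap) (T i)
  have hswap : ∀ σ, MeasurePreserving (swap σ) ρ ρ := fun σ ↦ by
    refine measurePreserving_pi (fun _ : Fin n ↦ μ.prod μ) (fun _ : Fin n ↦ μ.prod μ)
      (f := fun i ↦ if σ i = 1 then id else Prod.swap) fun i ↦ ?_
    split_ifs
    · exact MeasurePreserving.id _
    · exact Measure.measurePreserving_swap
  have hwswap : ∀ σ T, w (swap σ T)
      = ⨆ a, ∑ i, ((σ i : ℤ) : ℝ) * (h a (T i).1 - h a (T i).2) := by
    intro σ T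
    refine iSup_congr fun a ↦ Finset.sum_congr rfl fun i _ ↦ ?_
    rcases Int.units_eq_one_or (σ i) with hi | hi
    · simp [swap, hi]
    · simp [swap, hi]
  have hintσ : ∀ σ, ∫ T, w (swap σ T) ∂ρ = ∫ T, w T ∂ρ := fun σ ↦ by
    conv_rhs => rw [← (hswap σ).map_eq]
    rw [integral_map (hswap σ).measurable.aemeasurable hwm.aestronglyMeasurable]
  have hae : ∀ᵐ T ∂ρ, ∑ σ, w (swap σ T) ≤ 2 * (2 ^ n * B) := by
    have hall : ∀ᵐ T ∂ρ, ∀ i, p (T i).1 ∧ p (T i).2 := by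
      refine ae_all_iff.2 fun i ↦ ?_
      have he := measurePreserving_eval (fun _ : Fin n ↦ μ.prod μ) i
      have h1 : ∀ᵐ T ∂ρ, p (T i).1 :=
        (Measure.quasiMeasurePreserving_fst.comp he.quasiMeasurePreserving).ae hp
      have h2 : ∀ᵐ T ∂ρ, p (T i).2 :=
        (Measure.quasiMeasurePreserving_snd.comp he.quasiMeasurePreserving).ae hp
      exact h1.and h2
    filter_upwards [hall] with T hT
    have h1 := hpos (fun i ↦ (T i).1) fun i ↦ (hT i).1
    have h2 := hneg (fun i ↦ (T i).2) fun i ↦ (hT i).2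
    refine le_trans ?_ ((add_le_add h1 h2).trans_eq (by ring))
    rw [← Finset.sum_add_distrib]
    refine Finset.sum_le_sum fun σ _ ↦ ?_
    rw [hwswap]
    refine ciSup_le fun a ↦ ?_
    calc _ = ∑ i, ((σ i : ℤ) : ℝ) * h a (T i).1 + ∑ i, ((σ i : ℤ) : ℝ) * -h a (T i).2 := by
          rw [← Finset.sum_add_distrib]
          exact Finset.sum_congr rfl fun i _ ↦ by ring
      _ ≤ _ := add_le_add
          (le_ciSup (f := fun a ↦ ∑ i, ((σ i : ℤ) : ℝ) * h a (T i).1)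
            (Finite.bddAbove_range _) a)
          (le_ciSup (f := fun a ↦ ∑ i, ((σ i : ℤ) : ℝ) * -h a (T i).2)
            (Finite.bddAbove_range _) a)
  have hσint : ∀ σ, Integrable (fun T ↦ w (swap σ T)) ρ := fun σ ↦
    (hswap σ).integrable_comp_of_integrable hwint
  have hsum : (2 : ℝ) ^ n * ∫ T, w T ∂ρ ≤ 2 * (2 ^ n * B) := by
    calc (2 : ℝ) ^ n * ∫ T, w T ∂ρ = ∑ σ : Fin n → ℤˣ, ∫ T, w (swap σ T) ∂ρ := by
          simp_rw [hintσ]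
          simp
      _ = ∫ T, ∑ σ, w (swap σ T) ∂ρ := (integral_finsetSum _ fun σ _ ↦ hσint σ).symm
      _ ≤ ∫ _T, 2 * (2 ^ n * B) ∂ρ :=
          integral_mono_ae (integrable_finsetSum _ fun σ _ ↦ hσint σ) (integrable_const _) hae
      _ = _ := by simp
  have h2n : (0 : ℝ) < 2 ^ n := by positivity
  refine hghost.trans (le_of_mul_le_mul_left (hsum.trans_eq (by ring)) h2n)

/-- Deviation bound for a finite class of `[0, 1]`-valued functions. -/
theorem measure_exists_sum_integral_sub_gt_le {ι Z : Type*} [Finite ι] [Nonempty ι]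
    [MeasurableSpace Z] (μ : Measure Z) [IsProbabilityMeasure μ] {n : ℕ} (hn : 1 ≤ n)
    (h : ι → Z → ℝ) (hm : ∀ a, Measurable (h a)) (hr : ∀ a z, h a z ∈ Set.Icc (0 : ℝ) 1)
    {p : Z → Prop} (hp : ∀ᵐ z ∂μ, p z) {B : ℝ}
    (hpos : ∀ S : Fin n → Z, (∀ i, p (S i)) →
      ∑ σ : Fin n → ℤˣ, ⨆ a, ∑ i, ((σ i : ℤ) : ℝ) * h a (S i) ≤ 2 ^ n * B)
    (hneg : ∀ S : Fin n → Z, (∀ i, p (S i)) →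
      ∑ σ : Fin n → ℤˣ, ⨆ a, ∑ i, ((σ i : ℤ) : ℝ) * -h a (S i) ≤ 2 ^ n * B)
    {δ : ℝ} (hδ : δ ∈ Set.Ioo (0 : ℝ) 1) :
    (Measure.pi fun _ : Fin n ↦ μ) {S | ∃ a, 2 * B + Real.sqrt (n * Real.log (1 / δ) / 2)
      < ∑ i, ((∫ z, h a z ∂μ) - h a (S i))} ≤ ENNReal.ofReal δ := by
  have hn' : (0 : ℝ) < n := by exact_mod_cast hn
  set π := Measure.pi fun _ : Fin n ↦ μ
  set F : (Fin n → Z) → ℝ := fun S ↦ ⨆ a, ∑ i, ((∫ z, h a z ∂μ) - h a (S i)) with hF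
  set ε := Real.sqrt (n * Real.log (1 / δ) / 2) with hε
  have hmean : ∀ a, (∫ z, h a z ∂μ) ∈ Set.Icc (0 : ℝ) 1 := fun a ↦
    ⟨integral_nonneg fun z ↦ (hr a z).1, by
      simpa using integral_mono (μ := μ) (Integrable.of_mem_Icc 0 1 (hm a).aemeasurable
        (Filter.Eventually.of_forall (hr a))) (integrable_const (1 : ℝ)) fun z ↦ (hr a z).2⟩
  have hFm : Measurable F := by
    refine Measurable.iSup fun a ↦ Finset.measurable_fun_sum _ fun i _ ↦ ?_
    have := hm a
    fun_prop
  have hle : ∀ S a, ∑ i, ((∫ z, h a z ∂μ) - h a (S i)) ≤ F S := fun S a ↦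
    le_ciSup (f := fun a ↦ ∑ i, ((∫ z, h a z ∂μ) - h a (S i))) (Finite.bddAbove_range _) a
  have hFC : ∀ S, |F S| ≤ n := by
    intro S
    obtain ⟨a, ha⟩ := exists_eq_ciSup_of_finite
      (f := fun a ↦ ∑ i, ((∫ z, h a z ∂μ) - h a (S i)))
    simp only [hF]
    rw [← ha]
    refine (Finset.abs_sum_le_sum_abs _ _).trans
      ((Finset.sum_le_sum (g := fun _ ↦ 1) fun i _ ↦ ?_).trans_eq (by simp))
    have h1 := hmean a
    have h2 := hr a (S i)
    exact abs_le.2 ⟨by linarith [h1.1, h2.2], by linarith [h1.2, h2.1]⟩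
  have honeside : ∀ i S S', (∀ j, j ≠ i → S j = S' j) → F S ≤ F S' + 1 := by
    intro i S S' hSS
    refine ciSup_le fun a ↦ ?_
    have h1 : ∑ i, ((∫ z, h a z ∂μ) - h a (S i)) - ∑ i, ((∫ z, h a z ∂μ) - h a (S' i))
        = h a (S' i) - h a (S i) := by
      rw [← Finset.sum_sub_distrib, Finset.sum_eq_single i]
      · ring
      · intro j _ hj
        rw [hSS j hj]
        ring
      · simp
    linarith [hle S' a, (hr a (S' i)).2, (hr a (S i)).1]
  have hsub := hasSubgaussianMGF_of_bounded_differences μ (c := 1) n F hFm hFC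
    fun i S S' hSS ↦ abs_le.2 ⟨by linarith [honeside i S' S fun j hj ↦ (hSS j hj).symm],
      by linarith [honeside i S S' hSS]⟩
  have htail := hsub.measure_ge_le (Real.sqrt_nonneg (n * Real.log (1 / δ) / 2))
  have hlog : 0 ≤ Real.log (1 / δ) := Real.log_nonneg (by
    rw [le_div_iff₀ hδ.1]
    linarith [hδ.2])
  have hexp : Real.exp (-ε ^ 2 / (2 * ((n * (‖(1 : ℝ)‖₊ / 2) ^ 2 : NNReal) : ℝ))) = δ := by
    rw [hε, Real.sq_sqrt (by positivity)]
    have : -(n * Real.log (1 / δ) / 2) / (2 * ((n * (‖(1 : ℝ)‖₊ / 2) ^ 2 : NNReal) : ℝ))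
        = Real.log δ := by
      rw [one_div, Real.log_inv]
      push_cast
      simp only [norm_one]
      field_simp
    rw [this, Real.exp_log hδ.1]
  rw [hexp] at htail
  have hES : ∫ S, F S ∂π ≤ 2 * B :=
    integral_ciSup_sum_integral_sub_le μ h hm hr hp hpos hneg
  calc π {S | ∃ a, 2 * B + ε < ∑ i, ((∫ z, h a z ∂μ) - h a (S i))}
      ≤ π {S | ε ≤ F S - ∫ S, F S ∂π} := by
        refine measure_mono ?_
        rintro S ⟨a, ha⟩
        have := hle S a
        change ε ≤ F S - ∫ S, F S ∂π
        linarith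
    _ = ENNReal.ofReal (π.real {S | ε ≤ F S - ∫ S, F S ∂π}) := by
        rw [ofReal_measureReal]
    _ ≤ _ := ENNReal.ofReal_le_ofReal htail

/-- Uniform deviation bound for a continuously parametrized class of `[0, 1]`-valued functions
whose finite subclasses have Rademacher sums bounded on average by `B`. -/
theorem ofReal_one_sub_le_measure_forall_integral_le {Θ Z : Type*} [TopologicalSpace Θ]
    [TopologicalSpace.SeparableSpace Θ] [FirstCountableTopology Θ] [Nonempty Θ]
    [MeasurableSpace Z] (μ : Measure Z) [IsProbabilityMeasure μ] {n : ℕ} (hn : 1 ≤ n)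
    (h : Θ → Z → ℝ) (hm : ∀ θ, Measurable (h θ)) (hr : ∀ θ z, h θ z ∈ Set.Icc (0 : ℝ) 1)
    (hc : ∀ z, Continuous fun θ ↦ h θ z) {p : Z → Prop} (hp : ∀ᵐ z ∂μ, p z) {B : ℝ}
    (hpos : ∀ (k : ℕ) (θ : Fin (k + 1) → Θ) (S : Fin n → Z), (∀ i, p (S i)) →
      ∑ σ : Fin n → ℤˣ, ⨆ a, ∑ i, ((σ i : ℤ) : ℝ) * h (θ a) (S i) ≤ 2 ^ n * B)
    (hneg : ∀ (k : ℕ) (θ : Fin (k + 1) → Θ) (S : Fin n → Z), (∀ i, p (S i)) →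
      ∑ σ : Fin n → ℤˣ, ⨆ a, ∑ i, ((σ i : ℤ) : ℝ) * -h (θ a) (S i) ≤ 2 ^ n * B)
    {δ : ℝ} (hδ : δ ∈ Set.Ioo (0 : ℝ) 1) :
    ENNReal.ofReal (1 - δ) ≤ (Measure.pi fun _ : Fin n ↦ μ)
      {S | ∀ θ, ∫ z, h θ z ∂μ ≤ (1 / (n : ℝ)) * ∑ i, h θ (S i) + 2 * B / n
        + Real.sqrt (Real.log (1 / δ) / (2 * n))} := by
  have hn' : (0 : ℝ) < n := by exact_mod_cast hn
  set π := Measure.pi fun _ : Fin n ↦ μ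
  set τ := 2 * B + Real.sqrt (n * Real.log (1 / δ) / 2) with hτ
  let d : ℕ → Θ := TopologicalSpace.denseSeq Θ
  set bad : ℕ → Set (Fin n → Z) := fun k ↦
    {S | ∃ a : Fin (k + 1), τ < ∑ i, ((∫ z, h (d a) z ∂μ) - h (d a) (S i))}
  have hbadk : ∀ k, π (bad k) ≤ ENNReal.ofReal δ := fun k ↦
    measure_exists_sum_integral_sub_gt_le μ hn (fun a : Fin (k + 1) ↦ h (d a)) (fun a ↦ hm _)
      (fun a ↦ hr _) hp (hpos k fun a ↦ d a) (hneg k fun a ↦ d a) hδ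
  have hmono : Monotone bad := by
    rintro k l hkl S ⟨a, ha⟩
    exact ⟨⟨a, by omega⟩, ha⟩
  have hunion : π (⋃ k, bad k) ≤ ENNReal.ofReal δ := by
    rw [hmono.measure_iUnion]
    exact iSup_le hbadk
  have hcint : Continuous fun θ ↦ ∫ z, h θ z ∂μ :=
    continuous_of_dominated (fun θ ↦ (hm θ).aestronglyMeasurable)
      (fun θ ↦ Filter.Eventually.of_forall fun z ↦ by
        rw [Real.norm_eq_abs, abs_of_nonneg (hr θ z).1]
        exact (hr θ z).2)
      (integrable_const (1 : ℝ)) (Filter.Eventually.of_forall hc)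
  have hsqrt : Real.sqrt (n * Real.log (1 / δ) / 2)
      = n * Real.sqrt (Real.log (1 / δ) / (2 * n)) := by
    rw [show n * Real.log (1 / δ) / 2 = (n : ℝ) ^ 2 * (Real.log (1 / δ) / (2 * n)) by field_simp,
      Real.sqrt_mul (by positivity), Real.sqrt_sq hn'.le]
  have hgood : (⋃ k, bad k)ᶜ ⊆ {S | ∀ θ, ∫ z, h θ z ∂μ ≤ (1 / (n : ℝ)) * ∑ i, h θ (S i)
      + 2 * B / n + Real.sqrt (Real.log (1 / δ) / (2 * n))} := by
    intro S hS θ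
    refine (TopologicalSpace.denseRange_denseSeq Θ).induction_on θ
      (isClosed_le hcint (by fun_prop)) fun k ↦ ?_
    have hk : ∑ i, ((∫ z, h (d k) z ∂μ) - h (d k) (S i)) ≤ τ := by
      by_contra! hlt
      exact hS (Set.mem_iUnion.2 ⟨k, ⟨⟨k, by omega⟩, hlt⟩⟩)
    rw [Finset.sum_sub_distrib, Finset.sum_const, Finset.card_univ, Fintype.card_fin,
      nsmul_eq_mul, hτ, hsqrt] at hk
    refine le_of_mul_le_mul_left ?_ hn'
    have : (n : ℝ) * ((1 / (n : ℝ)) * ∑ i, h (d k) (S i) + 2 * B / n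
        + Real.sqrt (Real.log (1 / δ) / (2 * n)))
        = ∑ i, h (d k) (S i) + 2 * B + n * Real.sqrt (Real.log (1 / δ) / (2 * n)) := by
      field_simp
    rw [this]
    linarith
  rw [ENNReal.ofReal_sub _ hδ.1.le, ENNReal.ofReal_one, tsub_le_iff_right]
  calc (1 : ENNReal) = π ((⋃ k, bad k)ᶜ ∪ ⋃ k, bad k) := by
        rw [Set.compl_union_self, measure_univ]
    _ ≤ π (⋃ k, bad k)ᶜ + π (⋃ k, bad k) := measure_union_le _ _
    _ ≤ _ := add_le_add (measure_mono hgood) hunion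

theorem log_one_add_two_mul_card_le (D P : ℕ) :
    Real.log (1 + 2 * (Fintype.card (Fin (P + 1) × Fin D) : ℝ))
      ≤ (2 + Real.sqrt (Real.log ((D : ℝ) * (P : ℝ) + (P : ℝ) + (D : ℝ)))) ^ 2 := by
  have hcard : (Fintype.card (Fin (P + 1) × Fin D) : ℝ) = (P + 1) * D := by simp
  rw [hcard]
  rcases Nat.eq_zero_or_pos (D * P + P + D) with hz | hpos
  · have hD : D = 0 := by omega
    subst hD
    simp only [Nat.cast_zero, mul_zero, add_zero, Real.log_one]
    positivity
  · have hK : (1 : ℝ) ≤ D * P + P + D := by exact_mod_cast hpos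
    set K : ℝ := D * P + P + D
    have hlogK : 0 ≤ Real.log K := Real.log_nonneg hK
    have hP : (0 : ℝ) ≤ P := Nat.cast_nonneg P
    have h3 : Real.log (1 + 2 * ((P + 1) * D)) ≤ Real.log (3 * K) :=
      Real.log_le_log (by positivity) (by linarith)
    rw [Real.log_mul (by norm_num) (by linarith)] at h3
    have h4 : Real.log 3 ≤ 2 := by linarith [Real.log_le_sub_one_of_pos (x := 3) (by norm_num)]
    nlinarith [Real.sq_sqrt hlogK, Real.sqrt_nonneg (Real.log K)]

theorem sum_abs_le_one_of_Omega_le_one {D P : ℕ} {lamP lam0 : ℝ} (hlamP : 1 ≤ lamP)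
    (hlam0 : 1 ≤ lam0) {A : Matrix (Fin D) (Fin (P + 1)) ℝ} (hA : Omega D P lamP lam0 A ≤ 1) :
    ∑ j : Fin (P + 1) × Fin D, |A j.2 j.1| ≤ 1 := by
  rw [Fintype.sum_prod_type]
  have h1 : 0 ≤ ∑ p : Fin P, (⨆ d, |A d p.succ|) :=
    Finset.sum_nonneg fun p _ ↦ Real.iSup_nonneg fun d ↦ abs_nonneg _
  have h2 : 0 ≤ ∑ p, ∑ d, |A d p| :=
    Finset.sum_nonneg fun p _ ↦ Finset.sum_nonneg fun d _ ↦ abs_nonneg _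
  unfold Omega at hA
  nlinarith

theorem pwPred_eq_sum_prod {D P : ℕ} (f : Fin (P + 1) → (Fin D → ℝ) → ℝ)
    (A : Matrix (Fin D) (Fin (P + 1)) ℝ) (x : Fin D → ℝ) :
    pwPred D P f A x = ∑ j : Fin (P + 1) × Fin D, A j.2 j.1 * (f j.1 x * x j.2) := by
  rw [Fintype.sum_prod_type, pwPred]
  refine Finset.sum_congr rfl fun p _ ↦ ?_
  rw [Finset.mul_sum]
  exact Finset.sum_congr rfl fun d _ ↦ by ring

/-- Generalization bound for the global and local residual model: with probability at
least `1 − δ` over an i.i.d. sample of size `N` from `𝒟` (supported on `‖x‖∞ ≤ 1`),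
simultaneously for every `A` with `Ω(A) ≤ 1`,
`E[ℓ(y, g_A(x))] ≤ (1/N)Σ_n ℓ(y_n, g_A(x_n)) + (2^{3/2}L/√N)(2 + √(ln(DP+P+D))) + √(ln(1/δ)/(2N))`. -/
theorem generalization_bound_global_local
    (N D P : ℕ) (hN : 1 ≤ N) (lamP lam0 : ℝ) (hlamP : 1 ≤ lamP) (hlam0 : 1 ≤ lam0)
    (L : ℝ) (hL : 0 < L) (δ : ℝ) (hδ : δ ∈ Set.Ioo (0 : ℝ) 1)
    {Y : Type*} [MeasurableSpace Y]
    (μ : Measure ((Fin D → ℝ) × Y)) [IsProbabilityMeasure μ]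
    (hsupp : ∀ᵐ q ∂μ, (⨆ d, |q.1 d|) ≤ 1)
    (ℓ : Y → ℝ → ℝ)
    (hℓmeas : Measurable fun q : Y × ℝ => ℓ q.1 q.2)
    (hℓrange : ∀ y t, ℓ y t ∈ Set.Icc (0 : ℝ) 1)
    (hℓlip : ∀ y s t, |ℓ y s - ℓ y t| ≤ L * |s - t|)
    (f : Fin (P + 1) → (Fin D → ℝ) → ℝ)
    (hf0 : ∀ z, f 0 z = 1)
    (hf01 : ∀ p z, f p z = 0 ∨ f p z = 1)
    (hfmeas : ∀ p, Measurable (f p)) :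
    ENNReal.ofReal (1 - δ) ≤
      (Measure.pi fun _ : Fin N => μ)
        {S : Fin N → (Fin D → ℝ) × Y |
          ∀ A : Matrix (Fin D) (Fin (P + 1)) ℝ, Omega D P lamP lam0 A ≤ 1 →
            (∫ q, ℓ q.2 (pwPred D P f A q.1) ∂μ) ≤
              (1 / (N : ℝ)) * ∑ n, ℓ (S n).2 (pwPred D P f A ((S n).1)) +
              (2 ^ ((3 : ℝ) / 2) * L / Real.sqrt N) *
                (2 + Real.sqrt (Real.log ((D : ℝ) * (P : ℝ) + (P : ℝ) + (D : ℝ)))) +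
              Real.sqrt (Real.log (1 / δ) / (2 * N))} := by
  have hN' : (0 : ℝ) < N := by exact_mod_cast hN
  have : SecondCountableTopology (Matrix (Fin D) (Fin (P + 1)) ℝ) :=
    inferInstanceAs (SecondCountableTopology (Fin D → Fin (P + 1) → ℝ))
  let Θ : Set (Matrix (Fin D) (Fin (P + 1)) ℝ) := {A | Omega D P lamP lam0 A ≤ 1}
  have : Nonempty Θ := ⟨⟨0, by simp [Θ, Omega]⟩⟩
  set q : ℝ := 2 + Real.sqrt (Real.log ((D : ℝ) * (P : ℝ) + (P : ℝ) + (D : ℝ)))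
  have hqpos : 0 < q := by positivity
  set h : Θ → (Fin D → ℝ) × Y → ℝ := fun A z ↦ ℓ z.2 (pwPred D P f A.1 z.1)
  have hgmeas : ∀ A, Measurable (pwPred D P f A) := fun A ↦ by
    unfold pwPred
    fun_prop
  have hm : ∀ A, Measurable (h A) := fun A ↦
    hℓmeas.comp (measurable_snd.prodMk ((hgmeas A.1).comp measurable_fst))
  have hℓcont : ∀ y, Continuous (ℓ y) := fun y ↦
    (LipschitzWith.of_dist_le_mul (K := ⟨L, hL.le⟩) fun s t ↦ hℓlip y s t).continuous
  have hc : ∀ z, Continuous fun A ↦ h A z := fun z ↦ by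
    refine (hℓcont z.2).comp ?_
    have hentry : ∀ d p, Continuous fun A : Θ ↦ A.1 d p := fun d p ↦
      continuous_subtype_val.matrix_elem d p
    exact continuous_finsetSum _ fun p _ ↦ continuous_const.mul
      (continuous_finsetSum _ fun d _ ↦ (hentry d p).mul_const _)
  have hrad : ∀ (k : ℕ) (A : Fin (k + 1) → Θ) (S : Fin N → (Fin D → ℝ) × Y),
      (∀ i, (⨆ d, |(S i).1 d|) ≤ 1) → ∀ φ : Fin N → Fin (k + 1) → ℝ,
      (∀ i a b, |φ i a - φ i b| = |h (A a) (S i) - h (A b) (S i)|) →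
      ∑ σ : Fin N → ℤˣ, ⨆ a, ∑ i, ((σ i : ℤ) : ℝ) * φ i a
        ≤ 2 ^ N * (L * (q * Real.sqrt (2 * N))) := by
    intro k A S hS φ hφ
    have hcontr := sum_ciSup_rademacher_contraction N 0 φ
      (fun i a ↦ L * pwPred D P f (A a).1 (S i).1) fun i a b ↦ by
        rw [hφ, ← mul_sub, abs_mul, abs_of_pos hL]
        exact hℓlip _ _ _
    simp only [Pi.zero_apply, zero_add] at hcontr
    have hmassart := sum_ciSup_rademacher_le_of_sum_abs_le_one
      (fun a (j : Fin (P + 1) × Fin D) ↦ (A a).1 j.2 j.1)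
      (fun a ↦ sum_abs_le_one_of_Omega_le_one hlamP hlam0 (A a).2)
      (fun j i ↦ f j.1 (S i).1 * (S i).1 j.2) (fun j i ↦ by
        have hx : |(S i).1 j.2| ≤ 1 :=
          (le_ciSup (f := fun d ↦ |(S i).1 d|) (Finite.bddAbove_range _) j.2).trans (hS i)
        rcases hf01 j.1 (S i).1 with h0 | h1
        · simp [h0]
        · simpa [h1] using hx)
      hqpos (log_one_add_two_mul_card_le D P)
    refine hcontr.trans ?_
    calc _ = L * ∑ σ : Fin N → ℤˣ, ⨆ a, ∑ i, ((σ i : ℤ) : ℝ) *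
          ∑ j : Fin (P + 1) × Fin D, (A a).1 j.2 j.1 * (f j.1 (S i).1 * (S i).1 j.2) := by
          rw [Finset.mul_sum]
          refine Finset.sum_congr rfl fun σ _ ↦ ?_
          rw [Real.mul_iSup_of_nonneg hL.le]
          refine iSup_congr fun a ↦ ?_
          rw [Finset.mul_sum]
          refine Finset.sum_congr rfl fun i _ ↦ ?_
          rw [pwPred_eq_sum_prod]
          ring
      _ ≤ L * (2 ^ N * (q * Real.sqrt (2 * N))) := by gcongr
      _ = _ := by ring
  have hmain := ofReal_one_sub_le_measure_forall_integral_le μ hN h hm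
    (fun A z ↦ hℓrange _ _) hc hsupp
    (fun k A S hS ↦ hrad k A S hS (fun i a ↦ h (A a) (S i)) fun _ _ _ ↦ rfl)
    (fun k A S hS ↦ hrad k A S hS (fun i a ↦ -h (A a) (S i)) fun i a b ↦ by
      rw [neg_sub_neg, abs_sub_comm]) hδ
  refine hmain.trans (measure_mono fun S hS A hA ↦ (hS ⟨A, hA⟩).trans_eq ?_)
  have hrate : 2 * (L * (q * Real.sqrt (2 * N))) / N
      = 2 ^ ((3 : ℝ) / 2) * L / Real.sqrt N * q := by
    have h2 : (2 : ℝ) ^ ((3 : ℝ) / 2) = 2 * Real.sqrt 2 := by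
      rw [show (3 : ℝ) / 2 = 1 + 1 / 2 by norm_num, Real.rpow_add (by norm_num),
        Real.rpow_one, Real.sqrt_eq_rpow]
    have hs : Real.sqrt N ≠ 0 := (Real.sqrt_pos.2 hN').ne'
    rw [h2, Real.sqrt_mul (by norm_num)]
    field_simp
    rw [Real.sq_sqrt hN'.le]
  rw [hrate]
end
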